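/- arXiv:2110.06557 — 7 statements merged into one kernel-verified Lean document; each statement's English description precedes it below -/
import Mathlib

section
/- Let E be a finite-dimensional real normed vector space, let L, S : E → E be C^∞ maps, define the Cauchy–Kovalevskaya operator ℒ_t(Q) := DL(Q)[L(Q) + S(Q)], and let Q : ℝ → E solve Q'(t) = L(Q(t)) + S(Q(t)) on a neighborhood of t_n with Q^n := Q(t_n). Suppose that for each Δt ∈ (0, δ) there are elements Q*(Δt), Q^{n+1}(Δt) ∈ E satisfying the implicit two-stage scheme Q* = Q^n + (Δt/2) L(Q^n) + (Δt²/8) ℒ_t(Q^n) + (Δt/4)(S(Q^n) + S(Q*)) and Q^{n+1} = Q^n + Δt L(Q^n) + (Δt²/6)(ℒ_t(Q^n) + 2 ℒ_t(Q*)) + (Δt/6)(S(Q^n) + 4 S(Q*) + S(Q^{n+1})), and that Q*(Δt) → Q^n and Q^{n+1}(Δt) → Q^n as Δt → 0⁺. Then the scheme is third-order accurate: there exist C > 0 and δ' > 0 such that ‖Q^{n+1}(Δt) − Q(t_n + Δt)‖ ≤ C Δt⁴ for all Δt ∈ (0, δ'). -/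
open scoped Topology
open Filter Asymptotics

theorem imex_integ {E : Type*} [NormedAddCommGroup E] [NormedSpace ℝ E]
    (F F' : ℝ → E) (n : ℕ) (hF : ∀ᶠ h in 𝓝 (0:ℝ), HasDerivAt F (F' h) h)
    (hO : F' =O[𝓝 0] fun h : ℝ => h ^ n) (h0 : F 0 = 0) :
    F =O[𝓝 0] fun h : ℝ => h ^ (n+1) := by
  obtain ⟨c, hc⟩ := hO.bound
  obtain ⟨r, hr, hb⟩ := Metric.eventually_nhds_iff.1 (hF.and hc)
  refine IsBigO.of_bound c ?_
  filter_upwards [Metric.ball_mem_nhds (0:ℝ) hr] with h hh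
  rw [Metric.mem_ball] at hh
  have hs : ∀ x ∈ Metric.closedBall (0:ℝ) |h|, HasDerivAt F (F' x) x ∧ ‖F' x‖ ≤ c * ‖x ^ n‖ := by
    intro x hx
    apply hb
    rw [Metric.mem_closedBall] at hx
    rw [Real.dist_eq, sub_zero] at *
    linarith
  have hc0 : 0 ≤ c * |h| ^ n := by
    have := (hs h (by simp)).2
    rw [norm_pow, Real.norm_eq_abs] at this
    exact (norm_nonneg _).trans this
  have key := (convex_closedBall (0:ℝ) |h|).norm_image_sub_le_of_norm_hasDerivWithin_le
    (f := F) (f' := F') (C := c * |h| ^ n) (x := 0) (y := h)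
    (fun x hx => (hs x hx).1.hasDerivWithinAt) ?_ (by simp) (by simp)
  · rw [h0, sub_zero, sub_zero] at key
    rw [norm_pow, pow_succ, ← mul_assoc]
    exact key
  · intro x hx
    refine (hs x hx).2.trans ?_
    rw [Metric.mem_closedBall, Real.dist_eq, sub_zero] at hx
    rw [norm_pow, Real.norm_eq_abs]
    by_cases hcn : 0 ≤ c
    · gcongr
    · push Not at hcn
      have hx0 := (norm_nonneg _).trans (hs x (by simpa using hx)).2
      rw [norm_pow, Real.norm_eq_abs] at hx0
      have : c * |x| ^ n ≤ 0 := mul_nonpos_of_nonpos_of_nonneg hcn.le (by positivity)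
      linarith

theorem imex_chain {E : Type*} [NormedAddCommGroup E] [NormedSpace ℝ E]
    (V G : E → E) (hG : ContDiff ℝ (⊤ : ℕ∞) G)
    (q : ℝ → E) (hq : ∀ᶠ h in 𝓝 (0:ℝ), HasDerivAt q (V (q h)) h) :
    ∀ᶠ h in 𝓝 (0:ℝ), HasDerivAt (fun h => G (q h)) (fderiv ℝ G (q h) (V (q h))) h := by
  filter_upwards [hq] with h hh
  exact ((hG.differentiable (by simp)) (q h)).hasFDerivAt.comp_hasDerivAt h hh

theorem imex_taylor {E : Type*} [NormedAddCommGroup E] [NormedSpace ℝ E]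
    (V G G1 : E → E) (hV : ContDiff ℝ (⊤ : ℕ∞) V) (hG : ContDiff ℝ (⊤ : ℕ∞) G)
    (hG1 : ∀ x, G1 x = fderiv ℝ G x (V x))
    (q : ℝ → E) (hq : ∀ᶠ h in 𝓝 (0:ℝ), HasDerivAt q (V (q h)) h) :
    ∃ a : E, ((fun h : ℝ => G1 (q h) - G1 (q 0) - h • a) =O[𝓝 0] fun h : ℝ => h ^ 2) ∧
     ((fun h : ℝ => G (q h) - G (q 0) - h • G1 (q 0) - (h^2/2) • a) =O[𝓝 0] fun h : ℝ => h ^ 3) := by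
  have e1 : G1 = fun x => fderiv ℝ G x (V x) := funext hG1
  have hG1s : ContDiff ℝ (⊤ : ℕ∞) G1 := by
    rw [e1]
    exact (hG.fderiv_right (m := (⊤ : ℕ∞)) (by simp)).clm_apply hV
  have hG2s : ContDiff ℝ (⊤ : ℕ∞) (fun x => fderiv ℝ G1 x (V x)) :=
    (hG1s.fderiv_right (m := (⊤ : ℕ∞)) (by simp)).clm_apply hV
  have d0 := imex_chain V G hG q hq
  have d1 := imex_chain V G1 hG1s q hq
  have d2 := (imex_chain V _ hG2s q hq).self_of_nhds
  have o2 := d2.differentiableAt.isBigO_sub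
  have p1 : (fun h : ℝ => G1 (q h) - G1 (q 0) - h • (fderiv ℝ G1 (q 0) (V (q 0)))) =O[𝓝 0]
      fun h : ℝ => h ^ 2 := by
    refine imex_integ _ (fun h => fderiv ℝ G1 (q h) (V (q h)) - fderiv ℝ G1 (q 0) (V (q 0)))
      1 ?_ (by simpa using o2) (by simp)
    filter_upwards [d1] with h hh
    simpa using (hh.sub_const (G1 (q 0))).fun_sub ((hasDerivAt_id h).smul_const _)
  refine ⟨_, p1, ?_⟩
  refine imex_integ _ _ 2 ?_ p1 (by simp)
  filter_upwards [d0] with h hh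
  rw [← hG1] at hh
  have h2 : HasDerivAt (fun h : ℝ => h^2/2) h h := by
    simpa using ((hasDerivAt_pow 2 h).div_const 2)
  have := (((hh.sub_const (G (q 0))).fun_sub
    ((hasDerivAt_id h).smul_const (G1 (q 0)))).fun_sub (h2.smul_const (fderiv ℝ G1 (q 0) (V (q 0)))))
  simpa using this

theorem imex_absorb {E : Type*} [NormedAddCommGroup E] [NormedSpace ℝ E]
    (S : E → E) (hS : ContDiff ℝ (⊤ : ℕ∞) S) (p : E) (X Y d : ℝ → E) (c : ℝ)
    (hX : Tendsto X (𝓝[>] (0:ℝ)) (𝓝 p)) (hY : Tendsto Y (𝓝[>] (0:ℝ)) (𝓝 p))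
    (n : ℕ) (hd : d =O[𝓝[>] 0] fun h : ℝ => h ^ n)
    (he : ∀ᶠ h in 𝓝[>] (0:ℝ), X h - Y h = d h + (h * c) • (S (X h) - S (Y h))) :
    (fun h => X h - Y h) =O[𝓝[>] 0] fun h : ℝ => h ^ n := by
  have hs := (hS.contDiffAt (x := p)).hasStrictFDerivAt (by simp)
  have h1 : (fun h => S (X h) - S (Y h)) =O[𝓝[>] (0:ℝ)] (fun h => X h - Y h) :=
    hs.isBigO_sub.comp_tendsto (hX.prodMk_nhds hY)
  have h2 : (fun h : ℝ => h * c) =o[𝓝[>] (0:ℝ)] (fun _ => (1:ℝ)) := by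
    rw [isLittleO_one_iff]
    have : Tendsto (fun h : ℝ => h * c) (𝓝 0) (𝓝 (0 * c)) := by
      apply Continuous.tendsto; fun_prop
    rw [zero_mul] at this
    exact this.mono_left nhdsWithin_le_nhds
  have h3 := h2.smul_isBigO h1
  simp only [one_smul] at h3
  refine h3.right_isBigO_sub.trans (IsBigO.trans (EventuallyEq.isBigO ?_) hd)
  filter_upwards [he] with h hh
  rw [hh]; abel

/-- Third-order accuracy of the two-stage IMEX scheme for `Q' = L(Q) + S(Q)`. -/
theorem two_stage_imex_third_order
    {E : Type*} [NormedAddCommGroup E] [NormedSpace ℝ E] [FiniteDimensional ℝ E]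
    (L S : E → E) (hL : ContDiff ℝ (⊤ : ℕ∞) L) (hS : ContDiff ℝ (⊤ : ℕ∞) S)
    (Lt : E → E) (hLt : ∀ Q, Lt Q = fderiv ℝ L Q (L Q + S Q))
    (Q : ℝ → E) (tn : ℝ)
    (hQ : ∀ᶠ t in 𝓝 tn, HasDerivAt Q (L (Q t) + S (Q t)) t)
    (Qn : E) (hQn : Qn = Q tn)
    (δ : ℝ) (hδ : 0 < δ)
    (Qstar Qnext : ℝ → E)
    (hstar : ∀ Δt ∈ Set.Ioo (0:ℝ) δ,
      Qstar Δt = Qn + (Δt / 2) • L Qn + (Δt ^ 2 / 8) • Lt Qn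
        + (Δt / 4) • (S Qn + S (Qstar Δt)))
    (hnext : ∀ Δt ∈ Set.Ioo (0:ℝ) δ,
      Qnext Δt = Qn + Δt • L Qn
        + (Δt ^ 2 / 6) • (Lt Qn + (2:ℝ) • Lt (Qstar Δt))
        + (Δt / 6) • (S Qn + (4:ℝ) • S (Qstar Δt) + S (Qnext Δt)))
    (hstarlim : Filter.Tendsto Qstar (𝓝[>] (0:ℝ)) (𝓝 Qn))
    (hnextlim : Filter.Tendsto Qnext (𝓝[>] (0:ℝ)) (𝓝 Qn)) :
    ∃ C > 0, ∃ δ' > 0, ∀ Δt ∈ Set.Ioo (0:ℝ) δ',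
      ‖Qnext Δt - Q (tn + Δt)‖ ≤ C * Δt ^ 4 := by
  subst hQn
  obtain ⟨V, hVd⟩ : ∃ V : E → E, V = fun x => L x + S x := ⟨_, rfl⟩
  obtain ⟨q, hqd⟩ : ∃ q : ℝ → E, q = fun h => Q (tn + h) := ⟨_, rfl⟩
  have hV : ContDiff ℝ (⊤ : ℕ∞) V := by rw [hVd]; exact hL.add hS
  have q0 : q 0 = Q tn := by simp [hqd]
  have htn : Tendsto (fun h : ℝ => tn + h) (𝓝 0) (𝓝 tn) := by
    have : Tendsto (fun h : ℝ => tn + h) (𝓝 0) (𝓝 (tn + 0)) := by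
      apply Continuous.tendsto; fun_prop
    simpa using this
  have hq : ∀ᶠ h in 𝓝 (0:ℝ), HasDerivAt q (V (q h)) h := by
    filter_upwards [htn.eventually hQ] with h hh
    rw [hqd, hVd]
    exact hh.comp_const_add tn h
  obtain ⟨f2, rf1, rf⟩ := imex_taylor V L Lt hV hL (by simpa [hVd] using hLt) q hq
  obtain ⟨g2, -, rg⟩ := imex_taylor V S (fun x => fderiv ℝ S x (V x)) hV hS (fun _ => rfl) q hq
  generalize hg1 : fderiv ℝ S (q 0) (V (q 0)) = g1 at rg
  have rq : (fun h : ℝ => q h - q 0 - h • (L (q 0) + S (q 0)) - (h^2/2) • (Lt (q 0) + g1)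
      - (h^3/6) • (f2 + g2)) =O[𝓝 0] fun h : ℝ => h ^ 4 := by
    refine imex_integ _ _ 3 ?_ (rf.add rg) (by simp)
    filter_upwards [hq] with h hh
    have h2 : HasDerivAt (fun h : ℝ => h^2/2) h h := by
      simpa using ((hasDerivAt_pow 2 h).div_const 2)
    have h3 : HasDerivAt (fun h : ℝ => h^3/6) (h^2/2) h := by
      refine ((hasDerivAt_pow 3 h).div_const 6).congr_deriv ?_
      norm_num; ring
    have := ((((hh.sub_const (q 0)).fun_sub
      ((hasDerivAt_id h).smul_const (L (q 0) + S (q 0)))).fun_sub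
        (h2.smul_const (Lt (q 0) + g1))).fun_sub (h3.smul_const (f2 + g2)))
    refine HasDerivAt.congr_deriv this ?_
    rw [hVd]
    module
  have half : Tendsto (fun h : ℝ => h / 2) (𝓝[>] 0) (𝓝 0) := by
    have : Tendsto (fun h : ℝ => h / 2) (𝓝 0) (𝓝 (0/2)) := by
      apply Continuous.tendsto; fun_prop
    rw [zero_div] at this
    exact this.mono_left nhdsWithin_le_nhds
  have hpow : ∀ n : ℕ, (fun h : ℝ => (h/2)^n) =O[𝓝[>] 0] fun h : ℝ => h ^ n := by
    intro n
    simp_rw [div_pow, div_eq_inv_mul]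
    exact (isBigO_refl _ _).const_mul_left _
  have rqh := (rq.comp_tendsto half).trans (hpow 4)
  have rgh := (rg.comp_tendsto half).trans (hpow 3)
  have rf1h := (rf1.comp_tendsto half).trans (hpow 2)
  have rq' := rq.mono (nhdsWithin_le_nhds (s := Set.Ioi 0))
  have rg' := rg.mono (nhdsWithin_le_nhds (s := Set.Ioi 0))
  have idO : ∀ c : ℝ, (fun h : ℝ => h * c) =O[𝓝[>] 0] fun h : ℝ => h ^ 1 := by
    intro c
    simp_rw [mul_comm _ c, pow_one]
    exact (isBigO_refl _ _).const_mul_left _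
  have sqO : ∀ c : ℝ, (fun h : ℝ => h ^ 2 * c) =O[𝓝[>] 0] fun h : ℝ => h ^ 2 := by
    intro c
    simp_rw [mul_comm _ c]
    exact (isBigO_refl _ _).const_mul_left _
  have cuO : ∀ c : E, (fun h : ℝ => h ^ 3 • c) =O[𝓝[>] 0] fun h : ℝ => h ^ 3 := by
    intro c
    simpa using (isBigO_refl (fun h : ℝ => h ^ 3) (𝓝[>] 0)).smul (isBigO_const_const c (one_ne_zero (α := ℝ)) (𝓝[>] (0:ℝ)))
  have powO : ∀ k : ℕ, (fun h : ℝ => h ^ (k+1)) =O[𝓝[>] 0] fun h : ℝ => h ^ k := by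
    intro k
    refine IsBigO.of_bound 1 ?_
    filter_upwards [Ioo_mem_nhdsGT (one_pos : (0:ℝ) < 1)] with h hh
    rw [norm_pow, norm_pow, Real.norm_eq_abs, abs_of_pos hh.1, one_mul]
    exact pow_le_pow_of_le_one hh.1.le hh.2.le (Nat.le_succ k)
  have p43 := powO 3
  have mulO : ∀ {k m : ℕ} {a : ℝ → ℝ} {b : ℝ → E}, a =O[𝓝[>] 0] (fun h : ℝ => h ^ k) →
      b =O[𝓝[>] 0] (fun h : ℝ => h ^ m) →
      (fun h => a h • b h) =O[𝓝[>] 0] fun h : ℝ => h ^ (k + m) := by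
    intro k m a b ha hb
    have := ha.smul hb
    simpa only [smul_eq_mul, ← pow_add] using this
  have hqc : Tendsto q (𝓝 0) (𝓝 (Q tn)) := by
    rw [← q0]; exact hq.self_of_nhds.continuousAt
  have ev : ∀ᶠ h in 𝓝[>] (0:ℝ), h ∈ Set.Ioo 0 δ := Ioo_mem_nhdsGT hδ
  -- first stage
  have st : (fun h => Qstar h - q (h/2)) =O[𝓝[>] 0] fun h : ℝ => h ^ 3 := by
    have hd := ((cuO ((1/32:ℝ) • g2 - (1/48:ℝ) • (f2 + g2))).add
      ((mulO (idO (1/4)) rgh).trans p43)).sub (rqh.trans p43)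
    refine imex_absorb S hS (Q tn) Qstar (fun h => q (h/2)) _ (1/4) hstarlim (hqc.comp half) 3 hd ?_
    filter_upwards [ev] with h hh
    have := hstar h hh
    simp only [Function.comp_apply]
    rw [← q0] at this
    have e : Qstar h - q (h/2) = (q 0 + (h / 2) • L (q 0) + (h ^ 2 / 8) • Lt (q 0)
        + (h / 4) • (S (q 0) + S (Qstar h))) - q (h/2) := by rw [← this]
    rw [e]
    module
  -- second stage
  have fin : (fun h => Qnext h - q h) =O[𝓝[>] 0] fun h : ℝ => h ^ 4 := by
    have hSst : (fun h => S (Qstar h) - S (q (h/2))) =O[𝓝[>] 0] fun h : ℝ => h ^ 3 := by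
      have hs := (hS.contDiffAt (x := Q tn)).hasStrictFDerivAt (by simp)
      exact (hs.isBigO_sub.comp_tendsto (hstarlim.prodMk_nhds (hqc.comp half))).trans st
    have hLtst : (fun h => Lt (Qstar h) - Lt (q (h/2))) =O[𝓝[>] 0] fun h : ℝ => h ^ 3 := by
      have hLts : ContDiff ℝ (⊤ : ℕ∞) Lt := by
        rw [show Lt = fun x => fderiv ℝ L x (L x + S x) from funext hLt]
        exact (hL.fderiv_right (m := (⊤ : ℕ∞)) (by simp)).clm_apply (hL.add hS)
      have hs := (hLts.contDiffAt (x := Q tn)).hasStrictFDerivAt (by simp)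
      exact (hs.isBigO_sub.comp_tendsto (hstarlim.prodMk_nhds (hqc.comp half))).trans st
    have hLtst2 := hLtst.trans (powO 2)
    have t1 := mulO (sqO (1/3)) hLtst2
    have t2 := mulO (idO (2/3)) hSst
    have t3 := mulO (sqO (1/3)) rf1h
    have t4 := mulO (idO (2/3)) rgh
    have t5 := mulO (idO (1/6)) rg'
    norm_num only at t1 t2 t3 t4 t5
    have hd := (((t1.add t2).add t3).add (t4.add t5)).sub rq'
    refine imex_absorb S hS (Q tn) Qnext q _ (1/6) hnextlim
      (hqc.mono_left nhdsWithin_le_nhds) 4 hd ?_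
    · filter_upwards [ev] with h hh
      have := hnext h hh
      simp only [Function.comp_apply]
      rw [← q0] at this
      have e : Qnext h - q h = (q 0 + h • L (q 0) + (h ^ 2 / 6) • (Lt (q 0) + (2:ℝ) • Lt (Qstar h)) +
        (h / 6) • (S (q 0) + (4:ℝ) • S (Qstar h) + S (Qnext h))) - q h := by rw [← this]
      rw [e]
      module
  · obtain ⟨C, hC, hb⟩ := fin.exists_pos
    obtain ⟨r, hr, hb⟩ := mem_nhdsGT_iff_exists_Ioo_subset.1 hb.bound
    refine ⟨C, hC, r, hr, fun h hh => ?_⟩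
    have := hb hh
    simp only [Set.mem_ofPred_eq, hqd, norm_pow, Real.norm_eq_abs, abs_of_pos hh.1] at this
    exact this
end

section
/- Let E be a finite-dimensional real normed vector space, let L, S : E → E be C^∞ maps, define ℒ_t(Q) := DL(Q)[L(Q) + S(Q)], and fix Q^n ∈ E. Suppose that for each Δt ∈ (0, δ) there is Q*(Δt) ∈ E satisfying the implicit first-stage equation Q* = Q^n + (Δt/2) L(Q^n) + (Δt²/8) ℒ_t(Q^n) + (Δt/4)(S(Q^n) + S(Q*)), and that Q*(Δt) → Q^n as Δt → 0⁺. Then Q*(Δt) − Q^n = (Δt/2)(L(Q^n) + S(Q^n)) + (Δt²/8)(DL(Q^n) + DS(Q^n))[L(Q^n) + S(Q^n)] + O(Δt³), i.e. there exist C > 0 and δ' > 0 such that the norm of the difference between the two sides is at most C Δt³ for all Δt ∈ (0, δ'). -/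
open scoped Topology

theorem taylor_two_aux {E : Type*} [NormedAddCommGroup E] [NormedSpace ℝ E]
    (S : E → E) (hS : ContDiff ℝ (⊤ : ℕ∞) S) (a : E) :
    (fun x => S x - S a - fderiv ℝ S a (x - a)) =O[𝓝 a] (fun x => ‖x - a‖ ^ 2) := by
  have hd : Differentiable ℝ S := hS.differentiable (by simp)
  have h1 : ContDiff ℝ 1 (fderiv ℝ S) := hS.fderiv_right (by norm_cast)
  have h2 := ((h1.differentiable (by simp)) a).isBigO_sub
  obtain ⟨K, hK⟩ := h2.bound
  obtain ⟨r, hr, hb⟩ := Metric.eventually_nhds_iff_ball.1 hK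
  refine Asymptotics.IsBigO.of_bound |K| ?_
  filter_upwards [Metric.ball_mem_nhds a hr] with y hy
  have hc : Convex ℝ (Metric.closedBall a ‖y - a‖) := convex_closedBall _ _
  have := hc.norm_image_sub_le_of_norm_hasFDerivWithin_le' (f := S) (f' := fderiv ℝ S)
    (φ := fderiv ℝ S a) (C := |K| * ‖y - a‖) (x := a) (y := y)
    (fun x _ => (hd x).hasFDerivAt.hasFDerivWithinAt)
    (fun x hx => by
      have hx' : ‖x - a‖ ≤ ‖y - a‖ := by simpa [dist_eq_norm] using hx
      have hy' : ‖y - a‖ < r := by simpa [dist_eq_norm] using hy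
      refine (hb x (by simpa [dist_eq_norm] using lt_of_le_of_lt hx' hy')).trans ?_
      exact mul_le_mul (le_abs_self K) hx' (norm_nonneg _) (abs_nonneg _))
    (by simp) (by simp [dist_eq_norm])
  refine this.trans (le_of_eq ?_)
  rw [Real.norm_of_nonneg (by positivity)]
  ring

/-- Expansion of the intermediate state of the two-stage IMEX scheme. -/
theorem imex_first_stage_expansion
    {E : Type*} [NormedAddCommGroup E] [NormedSpace ℝ E] [FiniteDimensional ℝ E]
    (L S : E → E) (hL : ContDiff ℝ (⊤ : ℕ∞) L) (hS : ContDiff ℝ (⊤ : ℕ∞) S)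
    (Lt : E → E) (hLt : ∀ Q, Lt Q = fderiv ℝ L Q (L Q + S Q))
    (Qn : E) (δ : ℝ) (hδ : 0 < δ)
    (Qstar : ℝ → E)
    (hstar : ∀ Δt ∈ Set.Ioo (0:ℝ) δ,
      Qstar Δt = Qn + (Δt / 2) • L Qn + (Δt ^ 2 / 8) • Lt Qn
        + (Δt / 4) • (S Qn + S (Qstar Δt)))
    (hstarlim : Filter.Tendsto Qstar (𝓝[>] (0:ℝ)) (𝓝 Qn)) :
    ∃ C > 0, ∃ δ' > 0, ∀ Δt ∈ Set.Ioo (0:ℝ) δ',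
      ‖Qstar Δt - Qn
        - ((Δt / 2) • (L Qn + S Qn)
          + (Δt ^ 2 / 8) • (fderiv ℝ L Qn (L Qn + S Qn)
            + fderiv ℝ S Qn (L Qn + S Qn)))‖ ≤ C * Δt ^ 3 := by
  have hd : Differentiable ℝ S := hS.differentiable (by simp)
  have hev : ∀ᶠ h in 𝓝[>] (0:ℝ), h ∈ Set.Ioo (0:ℝ) δ := Ioo_mem_nhdsGT hδ
  have hid : Filter.Tendsto (fun h : ℝ => h) (𝓝[>] (0:ℝ)) (𝓝 0) :=
    tendsto_nhdsWithin_of_tendsto_nhds Filter.tendsto_id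
  have hSlim : Filter.Tendsto (fun h => S (Qstar h)) (𝓝[>] (0:ℝ)) (𝓝 (S Qn)) :=
    (hd.continuous.tendsto Qn).comp hstarlim
  have hrefl : (fun h : ℝ => h) =O[𝓝[>] (0:ℝ)] (fun h : ℝ => h) := Asymptotics.isBigO_refl _ _
  -- first order
  have h1 : (fun h => Qstar h - Qn) =O[𝓝[>] (0:ℝ)] (fun h : ℝ => h) := by
    have hb : (fun h : ℝ => (1/2 : ℝ) • L Qn + (h / 8) • Lt Qn + (1/4 : ℝ) • (S Qn + S (Qstar h)))
        =O[𝓝[>] (0:ℝ)] (fun _ => (1:ℝ)) :=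
      Filter.Tendsto.isBigO_one ℝ
        ((tendsto_const_nhds.add ((hid.div_const 8).smul_const (Lt Qn))).add
          ((tendsto_const_nhds.add hSlim).const_smul (1/4 : ℝ)))
    have := hrefl.smul hb
    simp only [smul_eq_mul, mul_one] at this
    refine this.congr' ?_ Filter.EventuallyEq.rfl
    filter_upwards [hev] with h hh
    have e := hstar h hh
    rw [← sub_eq_zero] at e ⊢
    rw [← neg_eq_zero, ← e]
    module
  have h2 : (fun h => S (Qstar h) - S Qn) =O[𝓝[>] (0:ℝ)] (fun h : ℝ => h) :=
    ((hd Qn).isBigO_sub.comp_tendsto hstarlim).trans h1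
  have h3 : (fun h => Qstar h - Qn - (h / 2) • (L Qn + S Qn))
      =O[𝓝[>] (0:ℝ)] (fun h : ℝ => h ^ 2) := by
    have hb : (fun h : ℝ => (h / 8) • Lt Qn) =O[𝓝[>] (0:ℝ)] (fun h : ℝ => h) := by
      have := (hrefl.smul (Asymptotics.isBigO_const_const ((1/8 : ℝ) • Lt Qn)
        (one_ne_zero (α := ℝ)) (𝓝[>] (0:ℝ))))
      simp only [smul_eq_mul, mul_one] at this
      refine this.congr_left fun h => ?_
      module
    have := hrefl.smul (hb.add (h2.const_smul_left (1/4 : ℝ)))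
    refine this.congr' ?_ (Filter.Eventually.of_forall fun h => by simp [sq])
    filter_upwards [hev] with h hh
    have e := hstar h hh
    rw [← sub_eq_zero] at e ⊢
    rw [← neg_eq_zero, ← e]
    simp only [Pi.smul_apply]
    module
  have h4 : (fun h => S (Qstar h) - S Qn - fderiv ℝ S Qn (Qstar h - Qn))
      =O[𝓝[>] (0:ℝ)] (fun h : ℝ => h ^ 2) :=
    ((taylor_two_aux S hS Qn).comp_tendsto hstarlim).trans (h1.norm_left.pow 2)
  have h5 := ((fderiv ℝ S Qn).isBigO_comp
    (fun h => Qstar h - Qn - (h / 2) • (L Qn + S Qn)) (𝓝[>] (0:ℝ))).trans h3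
  have h6 := hrefl.smul ((h4.add h5).const_smul_left (1/4 : ℝ))
  have h7 : (fun h => Qstar h - Qn - ((h / 2) • (L Qn + S Qn)
          + (h ^ 2 / 8) • (fderiv ℝ L Qn (L Qn + S Qn)
            + fderiv ℝ S Qn (L Qn + S Qn)))) =O[𝓝[>] (0:ℝ)] (fun h : ℝ => h ^ 3) := by
    refine h6.congr' ?_ (Filter.Eventually.of_forall fun h => by simp only [smul_eq_mul]; ring)
    filter_upwards [hev] with h hh
    have e := hstar h hh
    rw [hLt] at e
    rw [← sub_eq_zero] at e ⊢
    rw [← neg_eq_zero, ← e]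
    simp only [Pi.smul_apply, map_sub, map_smul]
    module
  obtain ⟨C, hC, hb⟩ := h7.exists_pos
  obtain ⟨δ', hδ', hs⟩ := (mem_nhdsGT_iff_exists_Ioo_subset).1 hb.bound
  refine ⟨C, hC, δ', hδ', fun h hh => ?_⟩
  have := hs hh
  simp only [Set.mem_setOf_eq] at this
  rwa [Real.norm_of_nonneg (pow_nonneg hh.1.le 3)] at this
end

section
/- Let E be a finite-dimensional real normed vector space, let L, S : E → E be C^∞ maps, set F := L + S, define ℒ_t(Q) := DL(Q)[F(Q)], and fix Q^n ∈ E. Suppose that for each Δt ∈ (0, δ) there are Q*(Δt), Q^{n+1}(Δt) ∈ E satisfying Q* = Q^n + (Δt/2) L(Q^n) + (Δt²/8) ℒ_t(Q^n) + (Δt/4)(S(Q^n) + S(Q*)) and Q^{n+1} = Q^n + Δt L(Q^n) + (Δt²/6)(ℒ_t(Q^n) + 2 ℒ_t(Q*)) + (Δt/6)(S(Q^n) + 4 S(Q*) + S(Q^{n+1})), with Q*(Δt) → Q^n and Q^{n+1}(Δt) → Q^n as Δt → 0⁺. Then Q^{n+1}(Δt) − Q^n = Δt F(Q^n) + (Δt²/2)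 DF(Q^n)[F(Q^n)] + (Δt³/6)( D²F(Q^n)[F(Q^n), F(Q^n)] + DF(Q^n)[ DF(Q^n)[F(Q^n)] ] ) + O(Δt⁴), i.e. there exist C > 0 and δ' > 0 such that the norm of the difference between the two sides is at most C Δt⁴ for all Δt ∈ (0, δ'). -/
open scoped Topology

open Asymptotics Filter in
theorem aux_int {E G : Type*} [NormedAddCommGroup E] [NormedSpace ℝ E]
    [NormedAddCommGroup G] [NormedSpace ℝ G]
    (R : E → G) (hR : Differentiable ℝ R) (x0 : E) (h0 : R x0 = 0) (n : ℕ)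
    (h : (fderiv ℝ R) =O[𝓝 x0] (fun x => ‖x - x0‖ ^ n)) :
    R =O[𝓝 x0] (fun x => ‖x - x0‖ ^ (n+1)) := by
  obtain ⟨C, hC⟩ := h.bound
  obtain ⟨r, hr, hb⟩ := Metric.eventually_nhds_iff_ball.1 hC
  refine IsBigO.of_bound C ?_
  filter_upwards [Metric.ball_mem_nhds x0 hr] with x hx
  have hx' : ‖x - x0‖ < r := by simpa [dist_eq_norm] using hx
  have hC0 : ∀ y ∈ Metric.closedBall x0 ‖x - x0‖, ‖fderiv ℝ R y‖ ≤ |C| * ‖x - x0‖ ^ n := by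
    intro y hy
    have hy' : ‖y - x0‖ ≤ ‖x - x0‖ := by simpa [dist_eq_norm] using hy
    have := hb y (by simpa [dist_eq_norm] using hy'.trans_lt hx')
    refine this.trans ?_
    rw [norm_pow, norm_norm]
    gcongr
    exact le_abs_self C
  have hC1 : ∀ y ∈ Metric.closedBall x0 ‖x - x0‖, ‖fderiv ℝ R y‖ ≤ C * ‖x - x0‖ ^ n := by
    intro y hy
    have hy' : ‖y - x0‖ ≤ ‖x - x0‖ := by simpa [dist_eq_norm] using hy
    rcases le_or_gt 0 C with hc | hc
    · simpa [abs_of_nonneg hc] using hC0 y hy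
    · by_cases hxx : ‖x - x0‖ = 0
      · have : y = x := by
          have h1 : ‖y - x0‖ = 0 := le_antisymm (hy'.trans hxx.le) (norm_nonneg _)
          rw [norm_eq_zero, sub_eq_zero] at h1 hxx
          rw [h1, hxx]
        subst this
        simpa using hb y hx
      · exfalso
        have h1 := hb x hx
        have h2 : 0 < ‖x - x0‖ ^ n := pow_pos (lt_of_le_of_ne (norm_nonneg _) (Ne.symm hxx)) n
        rw [norm_pow, norm_norm] at h1
        have := norm_nonneg (fderiv ℝ R x)
        nlinarith
  have := (convex_closedBall x0 ‖x - x0‖).norm_image_sub_le_of_norm_fderiv_le (𝕜 := ℝ)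
    (fun y _ => hR y) hC1 (Metric.mem_closedBall_self (norm_nonneg _))
    (show x ∈ _ by simp [dist_eq_norm])
  rw [h0, sub_zero] at this
  rw [norm_pow, norm_norm, pow_succ]
  linarith

open Asymptotics Filter in
theorem aux_t0 {E G : Type*} [NormedAddCommGroup E] [NormedSpace ℝ E]
    [NormedAddCommGroup G] [NormedSpace ℝ G]
    (g : E → G) (hg : ContDiff ℝ (⊤ : ℕ∞) g) (x0 : E) :
    (fun x => g x - g x0) =O[𝓝 x0] (fun x => ‖x - x0‖ ^ 1) := by
  have hd : Differentiable ℝ g := hg.differentiable (by simp)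
  simpa using (hd x0).isBigO_sub.norm_right

open Asymptotics Filter in
theorem aux_t1 {E G : Type*} [NormedAddCommGroup E] [NormedSpace ℝ E]
    [NormedAddCommGroup G] [NormedSpace ℝ G]
    (g : E → G) (hg : ContDiff ℝ (⊤ : ℕ∞) g) (x0 : E) :
    (fun x => g x - g x0 - fderiv ℝ g x0 (x - x0)) =O[𝓝 x0] (fun x => ‖x - x0‖ ^ 2) := by
  have hd : Differentiable ℝ g := hg.differentiable (by simp)
  have hg' : ContDiff ℝ (⊤ : ℕ∞) (fderiv ℝ g) := hg.fderiv_right (by simp)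
  have key : ∀ x, HasFDerivAt (fun x => g x - g x0 - fderiv ℝ g x0 (x - x0))
      (fderiv ℝ g x - fderiv ℝ g x0) x := by
    intro x
    have h1 := ((hd x).hasFDerivAt.sub_const (g x0)).sub
      ((fderiv ℝ g x0).hasFDerivAt.comp x ((hasFDerivAt_id x).sub_const x0))
    exact h1
  refine aux_int _ (fun x => (key x).differentiableAt) x0 (by simp) 1 ?_
  have : fderiv ℝ (fun x => g x - g x0 - fderiv ℝ g x0 (x - x0))
      = fun x => fderiv ℝ g x - fderiv ℝ g x0 := funext fun x => (key x).fderiv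
  rw [this]
  exact aux_t0 _ hg' x0

open Asymptotics Filter in
theorem aux_t2 {E G : Type*} [NormedAddCommGroup E] [NormedSpace ℝ E]
    [NormedAddCommGroup G] [NormedSpace ℝ G]
    (g : E → G) (hg : ContDiff ℝ (⊤ : ℕ∞) g) (x0 : E) :
    (fun x => g x - g x0 - fderiv ℝ g x0 (x - x0)
      - (1/2 : ℝ) • fderiv ℝ (fderiv ℝ g) x0 (x - x0) (x - x0))
      =O[𝓝 x0] (fun x => ‖x - x0‖ ^ 3) := by
  have hd : Differentiable ℝ g := hg.differentiable (by simp)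
  have hg' : ContDiff ℝ (⊤ : ℕ∞) (fderiv ℝ g) := hg.fderiv_right (by simp)
  have hsymm : ∀ v w, fderiv ℝ (fderiv ℝ g) x0 v w = fderiv ℝ (fderiv ℝ g) x0 w v := by
    have : IsSymmSndFDerivAt ℝ g x0 := by
      apply hg.contDiffAt.isSymmSndFDerivAt
      simp [minSmoothness_of_isRCLikeNormedField]
      exact WithTop.coe_le_coe.2 (le_top : (2:ℕ∞) ≤ ⊤)
    exact fun v w => this v w
  have key : ∀ x, HasFDerivAt (fun x => g x - g x0 - fderiv ℝ g x0 (x - x0)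
      - (1/2 : ℝ) • fderiv ℝ (fderiv ℝ g) x0 (x - x0) (x - x0))
      (fderiv ℝ g x - fderiv ℝ g x0 - fderiv ℝ (fderiv ℝ g) x0 (x - x0)) x := by
    intro x
    have hx := (hasFDerivAt_id (𝕜 := ℝ) x).sub_const x0
    have h1 := ((hd x).hasFDerivAt.sub_const (g x0)).sub
      ((fderiv ℝ g x0).hasFDerivAt.comp x hx)
    have h2 := (((fderiv ℝ (fderiv ℝ g) x0).hasFDerivAt.comp x hx).clm_apply hx).const_smul
      (1/2 : ℝ)
    refine (h1.sub h2).congr_fderiv ?_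
    ext v
    simp [hsymm v]
    module
  refine aux_int _ (fun x => (key x).differentiableAt) x0 (by simp) 2 ?_
  rw [funext fun x => (key x).fderiv]
  exact aux_t1 _ hg' x0

section steps
open Asymptotics Filter

variable {E G : Type*} [NormedAddCommGroup E] [NormedSpace ℝ E]
    [NormedAddCommGroup G] [NormedSpace ℝ G]

theorem aux_pull (R : E → G) (x0 : E) (n : ℕ) (h : R =O[𝓝 x0] (fun x => ‖x - x0‖ ^ n))
    (X : ℝ → E) (hX : Tendsto X (𝓝[>] 0) (𝓝 x0))
    (h1 : (fun t => X t - x0) =O[𝓝[>] 0] (fun t : ℝ => t ^ 1)) :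
    (fun t => R (X t)) =O[𝓝[>] 0] (fun t : ℝ => t ^ n) := by
  have := (h.comp_tendsto hX).trans (h1.norm_left.pow n)
  simpa [Function.comp_def] using this

theorem aux_pow {m n : ℕ} (h : m ≤ n) :
    (fun t : ℝ => t ^ n) =O[𝓝[>] 0] (fun t : ℝ => t ^ m) := 
  (IsBigO.of_bound 1 (by
    filter_upwards [Ioo_mem_nhdsGT (zero_lt_one (α := ℝ))] with t ht
    rw [one_mul, norm_pow, norm_pow]
    exact pow_le_pow_of_le_one (norm_nonneg _)
      (by rw [Real.norm_of_nonneg ht.1.le]; exact ht.2.le) h))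

theorem aux_smul {u : ℝ → G} {n : ℕ} (k : ℕ) (c : ℝ)
    (h : u =O[𝓝[>] 0] (fun t : ℝ => t ^ n)) :
    (fun t => (c * t ^ k) • u t) =O[𝓝[>] 0] (fun t : ℝ => t ^ (k + n)) := by
  have h1 : (fun t : ℝ => c * t ^ k) =O[𝓝[>] 0] (fun t : ℝ => t ^ k) :=
    (isBigO_refl _ _).const_mul_left c
  simpa [pow_add] using h1.smul h

theorem aux_const (c : G) : (fun _ : ℝ => c) =O[𝓝[>] 0] (fun t : ℝ => t ^ 0) := by
  simpa using isBigO_const_const c (one_ne_zero (α := ℝ)) (𝓝[>] (0:ℝ))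

theorem aux_g0 (g : E → G) (hg : ContDiff ℝ (⊤ : ℕ∞) g) (x0 : E)
    (X : ℝ → E) (hX : Tendsto X (𝓝[>] 0) (𝓝 x0))
    (h1 : (fun t => X t - x0) =O[𝓝[>] 0] (fun t : ℝ => t ^ 1)) :
    (fun t => g (X t) - g x0) =O[𝓝[>] 0] (fun t : ℝ => t ^ 1) :=
  aux_pull _ x0 1 (aux_t0 g hg x0) X hX h1

theorem aux_g1 (g : E → G) (hg : ContDiff ℝ (⊤ : ℕ∞) g) (x0 : E)
    (X : ℝ → E) (hX : Tendsto X (𝓝[>] 0) (𝓝 x0))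
    (h1 : (fun t => X t - x0) =O[𝓝[>] 0] (fun t : ℝ => t ^ 1)) (c : E)
    (h2 : (fun t => X t - x0 - t • c) =O[𝓝[>] 0] (fun t : ℝ => t ^ 2)) :
    (fun t => g (X t) - g x0 - t • fderiv ℝ g x0 c) =O[𝓝[>] 0] (fun t : ℝ => t ^ 2) := by
  have a := aux_pull _ x0 2 (aux_t1 g hg x0) X hX h1
  have b := ((fderiv ℝ g x0).isBigO_comp _ _).trans h2
  refine (a.add b).congr_left fun t => ?_
  simp only [map_sub, map_smul]
  abel

theorem aux_g2 (g : E → G) (hg : ContDiff ℝ (⊤ : ℕ∞) g) (x0 : E)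
    (X : ℝ → E) (hX : Tendsto X (𝓝[>] 0) (𝓝 x0))
    (h1 : (fun t => X t - x0) =O[𝓝[>] 0] (fun t : ℝ => t ^ 1)) (c d : E)
    (h2 : (fun t => X t - x0 - t • c) =O[𝓝[>] 0] (fun t : ℝ => t ^ 2))
    (h3 : (fun t => X t - x0 - t • c - t ^ 2 • d) =O[𝓝[>] 0] (fun t : ℝ => t ^ 3)) :
    (fun t => g (X t) - g x0 - t • fderiv ℝ g x0 c
      - t ^ 2 • (fderiv ℝ g x0 d + (1/2 : ℝ) • fderiv ℝ (fderiv ℝ g) x0 c c))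
      =O[𝓝[>] 0] (fun t : ℝ => t ^ 3) := by
  have a := aux_pull _ x0 3 (aux_t2 g hg x0) X hX h1
  have b := ((fderiv ℝ g x0).isBigO_comp _ _).trans h3
  set B := fderiv ℝ (fderiv ℝ g) x0
  have bil : ∀ (u v : ℝ → E) (m n : ℕ), u =O[𝓝[>] 0] (fun t : ℝ => t ^ m) →
      v =O[𝓝[>] 0] (fun t : ℝ => t ^ n) →
      (fun t => B (u t) (v t)) =O[𝓝[>] 0] (fun t : ℝ => t ^ (m+n)) := by
    intro u v m n hu hv
    have : (fun t => B (u t) (v t)) =O[𝓝[>] 0] (fun t => ‖u t‖ * ‖v t‖) :=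
      IsBigO.of_bound ‖B‖ (Eventually.of_forall fun t => by
        simpa [mul_assoc] using B.le_opNorm₂ (u t) (v t))
    simpa [pow_add] using this.trans (hu.norm_left.mul hv.norm_left)
  have e1 := bil _ _ 2 1 h2 h1
  have hc : (fun t : ℝ => t • c) =O[𝓝[>] 0] (fun t : ℝ => t ^ 1) := by
    simpa using aux_smul 1 1 (aux_const c)
  have e2 := bil _ _ 1 2 hc h2
  refine ((a.add b).add ((e1.add e2).const_smul_left (1/2:ℝ))).congr_left fun t => ?_
  have k : B (X t - x0 - t • c) (X t - x0) + B (t • c) (X t - x0 - t • c)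
      = B (X t - x0) (X t - x0) - t ^ 2 • B c c := by
    generalize X t - x0 = u
    rw [map_sub B u, map_smul B t c, map_sub, sub_apply, smul_apply, map_smul]
    simp only [smul_sub, smul_smul, smul_apply]
    rw [pow_two]
    abel
  simp only [Pi.smul_apply]
  rw [k, map_sub _ (X t - x0 - t • c), map_sub _ (X t - x0) (t • c), map_smul, map_smul]
  module

end steps

open Asymptotics Filter in
/-- The two-stage IMEX update reproduces the third-order Taylor expansion of the
exact flow of `Q' = F(Q)` with `F = L + S`. -/
theorem imex_update_expansion
    {E : Type*} [NormedAddCommGroup E] [NormedSpace ℝ E] [FiniteDimensional ℝ E]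
    (L S : E → E) (hL : ContDiff ℝ (⊤ : ℕ∞) L) (hS : ContDiff ℝ (⊤ : ℕ∞) S)
    (F : E → E) (hF : ∀ Q, F Q = L Q + S Q)
    (Lt : E → E) (hLt : ∀ Q, Lt Q = fderiv ℝ L Q (F Q))
    (Qn : E) (δ : ℝ) (hδ : 0 < δ)
    (Qstar Qnext : ℝ → E)
    (hstar : ∀ Δt ∈ Set.Ioo (0:ℝ) δ,
      Qstar Δt = Qn + (Δt / 2) • L Qn + (Δt ^ 2 / 8) • Lt Qn
        + (Δt / 4) • (S Qn + S (Qstar Δt)))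
    (hnext : ∀ Δt ∈ Set.Ioo (0:ℝ) δ,
      Qnext Δt = Qn + Δt • L Qn
        + (Δt ^ 2 / 6) • (Lt Qn + (2:ℝ) • Lt (Qstar Δt))
        + (Δt / 6) • (S Qn + (4:ℝ) • S (Qstar Δt) + S (Qnext Δt)))
    (hstarlim : Filter.Tendsto Qstar (𝓝[>] (0:ℝ)) (𝓝 Qn))
    (hnextlim : Filter.Tendsto Qnext (𝓝[>] (0:ℝ)) (𝓝 Qn)) :
    ∃ C > 0, ∃ δ' > 0, ∀ Δt ∈ Set.Ioo (0:ℝ) δ',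
      ‖Qnext Δt - Qn
        - (Δt • F Qn
          + (Δt ^ 2 / 2) • fderiv ℝ F Qn (F Qn)
          + (Δt ^ 3 / 6) • (fderiv ℝ (fderiv ℝ F) Qn (F Qn) (F Qn)
            + fderiv ℝ F Qn (fderiv ℝ F Qn (F Qn))))‖ ≤ C * Δt ^ 4 := by
  have hFe : F = fun Q => L Q + S Q := funext hF
  have hLte : Lt = fun Q => fderiv ℝ L Q (F Q) := funext hLt
  have hFs : ContDiff ℝ (⊤ : ℕ∞) F := hFe ▸ hL.add hS
  have hL' : ContDiff ℝ (⊤ : ℕ∞) (fderiv ℝ L) := hL.fderiv_right (by simp)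
  have hS' : ContDiff ℝ (⊤ : ℕ∞) (fderiv ℝ S) := hS.fderiv_right (by simp)
  have hLts : ContDiff ℝ (⊤ : ℕ∞) Lt := hLte ▸ hL'.clm_apply hFs
  have dL : Differentiable ℝ L := hL.differentiable (by simp)
  have dS : Differentiable ℝ S := hS.differentiable (by simp)
  have dF : Differentiable ℝ F := hFs.differentiable (by simp)
  have dL' : Differentiable ℝ (fderiv ℝ L) := hL'.differentiable (by simp)
  have dS' : Differentiable ℝ (fderiv ℝ S) := hS'.differentiable (by simp)
  have F1 : fderiv ℝ F = fun Q => fderiv ℝ L Q + fderiv ℝ S Q := by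
    funext Q
    rw [hFe]
    exact fderiv_fun_add (dL Q) (dS Q)
  have F2 : fderiv ℝ (fderiv ℝ F) Qn = fderiv ℝ (fderiv ℝ L) Qn + fderiv ℝ (fderiv ℝ S) Qn := by
    rw [F1]
    exact fderiv_fun_add (dL' Qn) (dS' Qn)
  have Lt1 : ∀ v, fderiv ℝ Lt Qn v
      = fderiv ℝ L Qn (fderiv ℝ F Qn v) + fderiv ℝ (fderiv ℝ L) Qn v (F Qn) := by
    intro v
    rw [hLte, ((dL' Qn).hasFDerivAt.clm_apply (dF Qn).hasFDerivAt).fderiv]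
    simp
  have hev : ∀ᶠ t : ℝ in 𝓝[>] 0, t ∈ Set.Ioo (0:ℝ) δ := Ioo_mem_nhdsGT hδ
  have bdd : ∀ (g : E → E), ContDiff ℝ (⊤ : ℕ∞) g → ∀ X : ℝ → E, Tendsto X (𝓝[>] 0) (𝓝 Qn) →
      (fun t => g (X t)) =O[𝓝[>] 0] (fun t : ℝ => t ^ 0) := by
    intro g hg X hX
    have := ((hg.continuous.tendsto Qn).comp hX).isBigO_one ℝ
    simpa using this
  have f_eq : F Qn = L Qn + S Qn := hF Qn
  have F1v : ∀ v, fderiv ℝ F Qn v = fderiv ℝ L Qn v + fderiv ℝ S Qn v := by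
    intro v; rw [F1]; rfl
  have Lt0 : Lt Qn = fderiv ℝ L Qn (F Qn) := hLt Qn
  -- first stage
  have q1 : (fun t => Qstar t - Qn) =O[𝓝[>] 0] (fun t : ℝ => t ^ 1) := by
    have := ((aux_smul 1 (1/2) (aux_const (L Qn))).add
      ((aux_smul 2 (1/8) (aux_const (Lt Qn))).trans (aux_pow (by norm_num : 1 ≤ 2)))).add
      (aux_smul 1 (1/4) ((aux_const (S Qn)).add (bdd S hS _ hstarlim)))
    refine this.congr' ?_ EventuallyEq.rfl
    filter_upwards [hev] with t ht
    linear_combination (norm := module) (-1:ℝ) • (hstar t ht)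
  have s1 := aux_g0 S hS Qn Qstar hstarlim q1
  have q2 : (fun t => Qstar t - Qn - t • ((1/2:ℝ) • F Qn)) =O[𝓝[>] 0] (fun t : ℝ => t ^ 2) := by
    refine ((aux_smul 2 (1/8) (aux_const (Lt Qn))).add (aux_smul 1 (1/4) s1)).congr' ?_
      EventuallyEq.rfl
    filter_upwards [hev] with t ht
    rw [f_eq]
    linear_combination (norm := module) (-1:ℝ) • (hstar t ht)
  have s2 := aux_g1 S hS Qn Qstar hstarlim q1 _ q2
  have q3 : (fun t => Qstar t - Qn - t • ((1/2:ℝ) • F Qn) - t ^ 2 • ((1/8:ℝ) • fderiv ℝ F Qn (F Qn)))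
      =O[𝓝[>] 0] (fun t : ℝ => t ^ 3) := by
    refine (aux_smul 1 (1/4) s2).congr' ?_ EventuallyEq.rfl
    filter_upwards [hev] with t ht
    have h := hstar t ht
    rw [Lt0] at h
    rw [F1v, map_smul]
    linear_combination (norm := module) (-1:ℝ) • h + (t/2) • f_eq
  have s3 := aux_g2 S hS Qn Qstar hstarlim q1 _ _ q2 q3
  have l1 := aux_g0 Lt hLts Qn Qstar hstarlim q1
  have l2 := aux_g1 Lt hLts Qn Qstar hstarlim q1 _ q2
  -- second stage
  have p1 : (fun t => Qnext t - Qn) =O[𝓝[>] 0] (fun t : ℝ => t ^ 1) := by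
    have := ((aux_smul 1 1 (aux_const (L Qn))).add
      ((aux_smul 2 (1/6) ((aux_const (Lt Qn)).add
        ((bdd Lt hLts _ hstarlim).const_smul_left (2:ℝ)))).trans
          (aux_pow (by norm_num : 1 ≤ 2)))).add
      (aux_smul 1 (1/6) (((aux_const (S Qn)).add
        ((bdd S hS _ hstarlim).const_smul_left (4:ℝ))).add (bdd S hS _ hnextlim)))
    refine this.congr' ?_ EventuallyEq.rfl
    filter_upwards [hev] with t ht
    simp only [Pi.smul_apply]
    linear_combination (norm := module) (-1:ℝ) • (hnext t ht)
  have r1 := aux_g0 S hS Qn Qnext hnextlim p1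
  have p2 : (fun t => Qnext t - Qn - t • F Qn) =O[𝓝[>] 0] (fun t : ℝ => t ^ 2) := by
    refine ((aux_smul 2 (1/6) ((aux_const (Lt Qn)).add
        ((bdd Lt hLts _ hstarlim).const_smul_left (2:ℝ)))).add
        (aux_smul 1 (1/6) ((s1.const_smul_left (4:ℝ)).add r1))).congr' ?_
      EventuallyEq.rfl
    filter_upwards [hev] with t ht
    simp only [Pi.smul_apply]
    rw [f_eq]
    linear_combination (norm := module) (-1:ℝ) • (hnext t ht)
  have r2 := aux_g1 S hS Qn Qnext hnextlim p1 _ p2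
  have p3 : (fun t => Qnext t - Qn - t • F Qn - t ^ 2 • ((1/2:ℝ) • fderiv ℝ F Qn (F Qn)))
      =O[𝓝[>] 0] (fun t : ℝ => t ^ 3) := by
    refine ((aux_smul 2 (1/3) l1).add
        (aux_smul 1 (1/6) ((s2.const_smul_left (4:ℝ)).add r2))).congr' ?_
      EventuallyEq.rfl
    filter_upwards [hev] with t ht
    simp only [Pi.smul_apply]
    have h := hnext t ht
    rw [F1v, map_smul]
    linear_combination (norm := module) (-1:ℝ) • h + t • f_eq - (t^2/2) • Lt0
  have r3 := aux_g2 S hS Qn Qnext hnextlim p1 _ _ p2 p3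
  have fin : (fun t => Qnext t - Qn
        - (t • F Qn
          + (t ^ 2 / 2) • fderiv ℝ F Qn (F Qn)
          + (t ^ 3 / 6) • (fderiv ℝ (fderiv ℝ F) Qn (F Qn) (F Qn)
            + fderiv ℝ F Qn (fderiv ℝ F Qn (F Qn))))) =O[𝓝[>] 0] (fun t : ℝ => t ^ 4) := by
    refine ((aux_smul 2 (1/3) l2).add
        (aux_smul 1 (1/6) ((s3.const_smul_left (4:ℝ)).add r3))).congr' ?_
      EventuallyEq.rfl
    filter_upwards [hev] with t ht
    simp only [Pi.smul_apply]
    have h := hnext t ht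
    have F2v : fderiv ℝ (fderiv ℝ F) Qn (F Qn) (F Qn) = fderiv ℝ (fderiv ℝ L) Qn (F Qn) (F Qn)
        + fderiv ℝ (fderiv ℝ S) Qn (F Qn) (F Qn) := by rw [F2]; rfl
    rw [F2v, F1v (fderiv ℝ F Qn (F Qn))]
    simp only [map_smul, smul_apply, Lt1]
    have e := F1v (F Qn)
    linear_combination (norm := module) (-1:ℝ) • h + t • f_eq - (t^2/2) • Lt0 + (t^2/2) • e
  obtain ⟨C, hC, hb⟩ := fin.exists_pos
  obtain ⟨d, hd, hb'⟩ := mem_nhdsGT_iff_exists_Ioo_subset.1 hb.bound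
  refine ⟨C, hC, d, hd, fun t ht => ?_⟩
  have := hb' ht
  have h2 : ‖t ^ 4‖ = t ^ 4 := Real.norm_of_nonneg (by positivity)
  simpa only [Set.mem_ofPred_eq, h2] using this
end

section
/- For ρ, λ1, λ2 > 0, U, V ∈ ℝ and K1, K2 ∈ ℕ, define the modified equilibrium distribution g : ℝ × ℝ × ℝ^{K1} × ℝ^{K2} → ℝ by g(u, v, ξ1, ξ2) = ρ (λ1 λ2 / ((λ1 + λ2) π)) (λ1/π)^{K1/2} (λ2/π)^{K2/2} exp( −(λ1 λ2/(λ1 + λ2)) ((u − U)² + (v − V)²) − λ1 ‖ξ1‖² − λ2 ‖ξ2‖² ). Then g is integrable against the listed weights over ℝ^{2+K1+K2} and its conserved moments are: ∫ g dΞ = ρ, ∫ u g dΞ = ρ U, ∫ v g dΞ = ρ V, and ∫ (1/2)(u² + v² + ‖ξ1‖² + ‖ξ2‖²) g dΞ = (1/2) ρ ( U² + V² + (K1 + 2)/(2 λ1) + (K2 + 2)/(2 λ2) ), where dΞ = du dv dξ1 dξ2 is Lebesgue measure on ℝ^{2+K1+K2}. -/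
open MeasureTheory Real

/-- normalized one-dimensional Gaussian -/
noncomputable def gp (a m x : ℝ) : ℝ := √(a / π) * Real.exp (-a * (x - m) ^ 2)

lemma gp_eq (a m : ℝ) (ha : 0 < a) :
    gp a m = ProbabilityTheory.gaussianPDFReal m (Real.toNNReal (1 / (2 * a))) := by
  funext x
  unfold gp ProbabilityTheory.gaussianPDFReal
  rw [Real.coe_toNNReal _ (by positivity)]
  rw [← Real.sqrt_inv]
  congr 2
  · field_simp
  · field_simp

lemma gp_mom0 (a m : ℝ) (ha : 0 < a) : Integrable (gp a m) ∧ ∫ x, gp a m x = 1 := by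
  rw [gp_eq a m ha]
  refine ⟨ProbabilityTheory.integrable_gaussianPDFReal _ _, ?_⟩
  apply ProbabilityTheory.integral_gaussianPDFReal_eq_one
  exact (Real.toNNReal_pos.2 (by positivity)).ne'

lemma gp_int_iff (a m : ℝ) (ha : 0 < a) (f : ℝ → ℝ)
    (hf : Integrable f (ProbabilityTheory.gaussianReal m (Real.toNNReal (1 / (2 * a))))) :
    Integrable (fun x => f x * gp a m x) ∧ ∫ x, f x * gp a m x =
      ∫ x, f x ∂(ProbabilityTheory.gaussianReal m (Real.toNNReal (1 / (2 * a)))) := by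
  have h0 : (Real.toNNReal (1 / (2 * a))) ≠ 0 := by
    exact (Real.toNNReal_pos.2 (by positivity)).ne'
  constructor
  · rw [ProbabilityTheory.gaussianReal_of_var_ne_zero _ h0,
      integrable_withDensity_iff (ProbabilityTheory.measurable_gaussianPDF _ _)
        (by simp [ProbabilityTheory.gaussianPDF])] at hf
    simpa [ProbabilityTheory.toReal_gaussianPDF, gp_eq a m ha] using hf
  · rw [ProbabilityTheory.integral_gaussianReal_eq_integral_smul h0]
    simp [gp_eq a m ha, mul_comm]

lemma gp_mom1 (a m : ℝ) (ha : 0 < a) :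
    Integrable (fun x => x * gp a m x) ∧ ∫ x, x * gp a m x = m := by
  have := gp_int_iff a m ha (fun x => x)
    ((ProbabilityTheory.memLp_id_gaussianReal 1).integrable (by simp))
  simpa using this

lemma gp_mom2 (a m : ℝ) (ha : 0 < a) :
    Integrable (fun x => x ^ 2 * gp a m x) ∧ ∫ x, x ^ 2 * gp a m x = m ^ 2 + 1 / (2 * a) := by
  have h2 : MemLp id 2 (ProbabilityTheory.gaussianReal m (Real.toNNReal (1 / (2 * a)))) :=
    ProbabilityTheory.memLp_id_gaussianReal 2
  have := gp_int_iff a m ha (fun x => x ^ 2) h2.integrable_sq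
  refine ⟨this.1, this.2.trans ?_⟩
  have hv := ProbabilityTheory.variance_eq_sub h2
  rw [ProbabilityTheory.variance_id_gaussianReal] at hv
  rw [Real.coe_toNNReal _ (by positivity)] at hv
  simp only [Pi.pow_apply, id_eq, ProbabilityTheory.integral_id_gaussianReal] at hv
  linarith

/-- normalized K-dimensional Gaussian -/
noncomputable def gq (K : ℕ) (b : ℝ) (x : EuclideanSpace ℝ (Fin K)) : ℝ :=
  (b / π) ^ ((K : ℝ) / 2) * Real.exp (-b * ‖x‖ ^ 2)

lemma gq_eq (K : ℕ) (b : ℝ) (hb : 0 < b) (x : EuclideanSpace ℝ (Fin K)) :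
    gq K b x = ∏ i, gp b 0 (x i) := by
  unfold gq gp
  rw [Finset.prod_mul_distrib, ← Real.exp_sum, EuclideanSpace.real_norm_sq_eq, Finset.mul_sum]
  congr 1
  · rw [Finset.prod_const, Real.sqrt_eq_rpow, ← Real.rpow_mul_natCast (by positivity)]
    simp
    ring_nf
  · simp

lemma gpi (K : ℕ) (f : Fin K → ℝ → ℝ) (hf : ∀ i, Integrable (f i)) :
    Integrable (fun x : EuclideanSpace ℝ (Fin K) => ∏ i, f i (x i)) ∧
    ∫ x : EuclideanSpace ℝ (Fin K), ∏ i, f i (x i) = ∏ i, ∫ t, f i t := by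
  constructor
  · rw [← (PiLp.volume_preserving_toLp (Fin K)).integrable_comp_emb
      (MeasurableEquiv.toLp 2 _).measurableEmbedding]
    exact Integrable.fintype_prod hf
  · rw [← (PiLp.volume_preserving_toLp (Fin K)).integral_comp
      (MeasurableEquiv.toLp 2 _).measurableEmbedding]
    exact integral_fintype_prod_volume_eq_prod f

lemma gq_mom0 (K : ℕ) (b : ℝ) (hb : 0 < b) : Integrable (gq K b) ∧ ∫ x, gq K b x = 1 := by
  have h := gpi K (fun _ => gp b 0) (fun _ => (gp_mom0 b 0 hb).1)
  have e : gq K b = fun x => ∏ i, gp b 0 (x i) := funext (gq_eq K b hb)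
  rw [e]
  refine ⟨h.1, h.2.trans ?_⟩
  simp [(gp_mom0 b 0 hb).2]

lemma gq_mom2 (K : ℕ) (b : ℝ) (hb : 0 < b) :
    Integrable (fun x => ‖x‖ ^ 2 * gq K b x) ∧ ∫ x, ‖x‖ ^ 2 * gq K b x = K / (2 * b) := by
  have h := fun j : Fin K => gpi K
    (fun i => if i = j then (fun x => x ^ 2 * gp b 0 x) else gp b 0)
    (fun i => by
      split_ifs
      · exact (gp_mom2 b 0 hb).1
      · exact (gp_mom0 b 0 hb).1)
  have e : (fun x => ‖x‖ ^ 2 * gq K b x) = fun x : EuclideanSpace ℝ (Fin K) =>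
      ∑ j, ∏ i, (if i = j then (fun x => x ^ 2 * gp b 0 x) else gp b 0) (x i) := by
    funext x
    rw [gq_eq K b hb, EuclideanSpace.real_norm_sq_eq, Finset.sum_mul]
    refine Finset.sum_congr rfl fun j _ => ?_
    rw [← Finset.mul_prod_erase _ _ (Finset.mem_univ j),
      ← Finset.mul_prod_erase _ (fun i => (if i = j then _ else _ : ℝ → ℝ) (x i))
        (Finset.mem_univ j)]
    simp only [if_true]
    rw [← mul_assoc]
    congr 1
    refine Finset.prod_congr rfl fun i hi => ?_
    rw [if_neg (Finset.ne_of_mem_erase hi)]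
  rw [e]
  refine ⟨integrable_finsetSum _ fun j _ => (h j).1, ?_⟩
  rw [integral_finsetSum _ fun j _ => (h j).1]
  have : ∀ j : Fin K, ∫ x : EuclideanSpace ℝ (Fin K),
      ∏ i, (if i = j then (fun x => x ^ 2 * gp b 0 x) else gp b 0) (x i) = 1 / (2 * b) := by
    intro j
    rw [(h j).2, ← Finset.mul_prod_erase _ _ (Finset.mem_univ j), Finset.prod_eq_one]
    · simp only [if_true, (gp_mom2 b 0 hb).2]
      ring
    · intro i hi
      rw [if_neg (Finset.ne_of_mem_erase hi), (gp_mom0 b 0 hb).2]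
  rw [Finset.sum_congr rfl fun j _ => this j]
  simp
  ring

lemma prod4 {K1 K2 : ℕ} {f1 f2 : ℝ → ℝ} {f3 : EuclideanSpace ℝ (Fin K1) → ℝ}
    {f4 : EuclideanSpace ℝ (Fin K2) → ℝ} {c1 c2 c3 c4 : ℝ}
    (h1 : Integrable f1 ∧ ∫ x, f1 x = c1) (h2 : Integrable f2 ∧ ∫ x, f2 x = c2)
    (h3 : Integrable f3 ∧ ∫ x, f3 x = c3) (h4 : Integrable f4 ∧ ∫ x, f4 x = c4) :
    Integrable (fun w : ℝ × ℝ × EuclideanSpace ℝ (Fin K1) × EuclideanSpace ℝ (Fin K2) =>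
      f1 w.1 * (f2 w.2.1 * (f3 w.2.2.1 * f4 w.2.2.2))) volume ∧
    ∫ w : ℝ × ℝ × EuclideanSpace ℝ (Fin K1) × EuclideanSpace ℝ (Fin K2),
      f1 w.1 * (f2 w.2.1 * (f3 w.2.2.1 * f4 w.2.2.2)) = c1 * (c2 * (c3 * c4)) := by
  constructor
  · exact h1.1.mul_prod (h2.1.mul_prod (h3.1.mul_prod h4.1))
  · rw [← h1.2, ← h2.2, ← h3.2, ← h4.2, ← integral_prod_mul f3 f4,
      ← integral_prod_mul f2 (fun w : EuclideanSpace ℝ (Fin K1) × EuclideanSpace ℝ (Fin K2) => f3 w.1 * f4 w.2),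
      ← integral_prod_mul f1 (fun w : ℝ × EuclideanSpace ℝ (Fin K1) × EuclideanSpace ℝ (Fin K2) => f2 w.1 * (f3 w.2.1 * f4 w.2.2))]
    rfl

lemma addM {X : Type*} [MeasureSpace X] {f h : X → ℝ} {c d : ℝ}
    (h1 : Integrable f ∧ ∫ x, f x = c) (h2 : Integrable h ∧ ∫ x, h x = d) :
    Integrable (fun x => f x + h x) ∧ ∫ x, (f x + h x) = c + d :=
  ⟨h1.1.add h2.1, by rw [integral_add h1.1 h2.1, h1.2, h2.2]⟩

lemma constM {X : Type*} [MeasureSpace X] {f h : X → ℝ} {c d : ℝ} (r : ℝ)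
    (h1 : Integrable f ∧ ∫ x, f x = c) (e : ∀ x, h x = r * f x) (e2 : d = r * c) :
    Integrable h ∧ ∫ x, h x = d := by
  have : h = fun x => r * f x := funext e
  rw [this, integral_const_mul, h1.2, e2]
  exact ⟨h1.1.const_mul r, rfl⟩

/-- Conserved moments of the modified equilibrium distribution. -/
theorem equilibrium_conserved_moments
    (K1 K2 : ℕ) (ρ l1 l2 U V : ℝ) (hρ : 0 < ρ) (hl1 : 0 < l1) (hl2 : 0 < l2)
    (g : ℝ → ℝ → EuclideanSpace ℝ (Fin K1) → EuclideanSpace ℝ (Fin K2) → ℝ)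
    (hg : ∀ u v ξ1 ξ2, g u v ξ1 ξ2
      = ρ * (l1 * l2 / ((l1 + l2) * π)) * (l1 / π) ^ ((K1 : ℝ) / 2)
          * (l2 / π) ^ ((K2 : ℝ) / 2)
          * Real.exp (-(l1 * l2 / (l1 + l2)) * ((u - U) ^ 2 + (v - V) ^ 2)
              - l1 * ‖ξ1‖ ^ 2 - l2 * ‖ξ2‖ ^ 2)) :
    (Integrable (fun w : ℝ × ℝ × EuclideanSpace ℝ (Fin K1) × EuclideanSpace ℝ (Fin K2) =>
        g w.1 w.2.1 w.2.2.1 w.2.2.2) volume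
      ∧ ∫ w : ℝ × ℝ × EuclideanSpace ℝ (Fin K1) × EuclideanSpace ℝ (Fin K2),
          g w.1 w.2.1 w.2.2.1 w.2.2.2 = ρ)
    ∧ (Integrable (fun w : ℝ × ℝ × EuclideanSpace ℝ (Fin K1) × EuclideanSpace ℝ (Fin K2) =>
        w.1 * g w.1 w.2.1 w.2.2.1 w.2.2.2) volume
      ∧ ∫ w : ℝ × ℝ × EuclideanSpace ℝ (Fin K1) × EuclideanSpace ℝ (Fin K2),
          w.1 * g w.1 w.2.1 w.2.2.1 w.2.2.2 = ρ * U)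
    ∧ (Integrable (fun w : ℝ × ℝ × EuclideanSpace ℝ (Fin K1) × EuclideanSpace ℝ (Fin K2) =>
        w.2.1 * g w.1 w.2.1 w.2.2.1 w.2.2.2) volume
      ∧ ∫ w : ℝ × ℝ × EuclideanSpace ℝ (Fin K1) × EuclideanSpace ℝ (Fin K2),
          w.2.1 * g w.1 w.2.1 w.2.2.1 w.2.2.2 = ρ * V)
    ∧ (Integrable (fun w : ℝ × ℝ × EuclideanSpace ℝ (Fin K1) × EuclideanSpace ℝ (Fin K2) =>
        (1 / 2) * (w.1 ^ 2 + w.2.1 ^ 2 + ‖w.2.2.1‖ ^ 2 + ‖w.2.2.2‖ ^ 2)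
          * g w.1 w.2.1 w.2.2.1 w.2.2.2) volume
      ∧ ∫ w : ℝ × ℝ × EuclideanSpace ℝ (Fin K1) × EuclideanSpace ℝ (Fin K2),
          (1 / 2) * (w.1 ^ 2 + w.2.1 ^ 2 + ‖w.2.2.1‖ ^ 2 + ‖w.2.2.2‖ ^ 2)
            * g w.1 w.2.1 w.2.2.1 w.2.2.2
        = (1 / 2) * ρ * (U ^ 2 + V ^ 2 + ((K1 : ℝ) + 2) / (2 * l1)
            + ((K2 : ℝ) + 2) / (2 * l2))) := by
  set a := l1 * l2 / (l1 + l2) with ha_def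
  have ha : 0 < a := by positivity
  have key : ∀ u v ξ1 ξ2, g u v ξ1 ξ2
      = ρ * (gp a U u * (gp a V v * (gq K1 l1 ξ1 * gq K2 l2 ξ2))) := by
    intro u v ξ1 ξ2
    rw [hg]
    unfold gp gq
    have e1 : l1 * l2 / ((l1 + l2) * π) = √(a / π) * √(a / π) := by
      rw [Real.mul_self_sqrt (by positivity), ha_def]
      field_simp
    have e2 : Real.exp (-a * ((u - U) ^ 2 + (v - V) ^ 2) - l1 * ‖ξ1‖ ^ 2 - l2 * ‖ξ2‖ ^ 2)
        = Real.exp (-a * (u - U) ^ 2) * Real.exp (-a * (v - V) ^ 2)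
          * Real.exp (-l1 * ‖ξ1‖ ^ 2) * Real.exp (-l2 * ‖ξ2‖ ^ 2) := by
      rw [← Real.exp_add, ← Real.exp_add, ← Real.exp_add]
      congr 1
      ring
    rw [e1, e2]
    ring
  have u0 := gp_mom0 a U ha
  have v0 := gp_mom0 a V ha
  have x0 := gq_mom0 K1 l1 hl1
  have y0 := gq_mom0 K2 l2 hl2
  have m0 := prod4 u0 v0 x0 y0
  have mu := prod4 (gp_mom1 a U ha) v0 x0 y0
  have mv := prod4 u0 (gp_mom1 a V ha) x0 y0
  have mu2 := prod4 (gp_mom2 a U ha) v0 x0 y0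
  have mv2 := prod4 u0 (gp_mom2 a V ha) x0 y0
  have mx2 := prod4 u0 v0 (gq_mom2 K1 l1 hl1) y0
  have my2 := prod4 u0 v0 x0 (gq_mom2 K2 l2 hl2)
  simp only [key]
  refine ⟨constM ρ m0 (fun w => by ring) (by ring), constM ρ mu (fun w => by ring) (by ring),
    constM ρ mv (fun w => by ring) (by ring),
    constM (1 / 2 * ρ) (addM (addM (addM mu2 mv2) mx2) my2) (fun w => by ring) ?_⟩
  rw [ha_def]
  field_simp
  ring
end

section
/- For ρ, λ1, λ2 > 0, U, V ∈ ℝ and K1, K2 ∈ ℕ, define the modified equilibrium distribution g : ℝ × ℝ × ℝ^{K1} × ℝ^{K2} → ℝ by g(u, v, ξ1, ξ2) = ρ (λ1 λ2 / ((λ1 + λ2) π)) (λ1/π)^{K1/2} (λ2/π)^{K2/2} exp( −(λ1 λ2/(λ1 + λ2)) ((u − U)² + (v − V)²) − λ1 ‖ξ1‖² − λ2 ‖ξ2‖² ). Then the flux moments are: ∫ u g dΞ = ρ U, ∫ u² g dΞ = ρ U² + ρ/(2 λ1) + ρ/(2 λ2), ∫ u v g dΞ = ρ U V, and ∫ u (1/2)(u²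 + v² + ‖ξ1‖² + ‖ξ2‖²) g dΞ = (1/2) ρ U ( U² + V² + (K1 + 4)/(2 λ1) + (K2 + 4)/(2 λ2) ), where dΞ = du dv dξ1 dξ2 is Lebesgue measure on ℝ^{2+K1+K2}. -/
open MeasureTheory Real

def HI {α : Type*} [MeasureSpace α] (f : α → ℝ) (c : ℝ) : Prop :=
  Integrable f volume ∧ ∫ x, f x = c

lemma HI.congr {α : Type*} [MeasureSpace α] {f f' : α → ℝ} {c c' : ℝ} (h : HI f c)
    (hf : ∀ x, f' x = f x) (hc : c' = c) : HI f' c' := by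
  have : f' = f := funext hf
  subst this; subst hc; exact h

lemma HI.add {α : Type*} [MeasureSpace α] {f f' : α → ℝ} {c c' : ℝ} (h : HI f c)
    (h' : HI f' c') : HI (fun x => f x + f' x) (c + c') :=
  ⟨h.1.add h'.1, by rw [integral_add h.1 h'.1, h.2, h'.2]⟩

lemma HI.smul {α : Type*} [MeasureSpace α] {f : α → ℝ} {c : ℝ} (k : ℝ) (h : HI f c) :
    HI (fun x => k * f x) (k * c) :=
  ⟨h.1.const_mul k, by rw [integral_const_mul, h.2]⟩

lemma HI.prod {α β : Type*} [MeasureSpace α] [MeasureSpace β]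
    [SFinite (volume : Measure α)] [SFinite (volume : Measure β)]
    {f : α → ℝ} {f' : β → ℝ} {c c' : ℝ} (h : HI f c)
    (h' : HI f' c') : HI (fun x : α × β => f x.1 * f' x.2) (c * c') :=
  ⟨h.1.mul_prod h'.1, by
    rw [Measure.volume_eq_prod, integral_prod_mul, h.2, h'.2]⟩

lemma int_pow (a : ℝ) (ha : 0 < a) (n : ℕ) :
    Integrable (fun x : ℝ => x ^ n * exp (-a * x ^ 2)) := by
  have := integrable_rpow_mul_exp_neg_mul_sq ha (s := n) (by
    have : (0:ℝ) ≤ n := n.cast_nonneg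
    linarith)
  simpa using this

lemma int_odd (f : ℝ → ℝ) (hf : ∀ x, f (-x) = - f x) : ∫ x, f x = 0 := by
  have h := integral_neg_eq_self f volume
  simp only [hf, integral_neg] at h
  linarith

lemma c0 (a : ℝ) (ha : 0 < a) : HI (fun x : ℝ => √(a/π) * exp (-a * x ^ 2)) 1 := by
  have h : HI (fun x : ℝ => exp (-a * x ^ 2)) (√(π / a)) :=
    ⟨by simpa using int_pow a ha 0, integral_gaussian a⟩
  refine (h.smul (√(a/π))).congr (fun x => rfl) ?_
  rw [← Real.sqrt_mul (by positivity)]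
  have := Real.pi_pos
  field_simp
  simp

lemma c1 (a : ℝ) (ha : 0 < a) : HI (fun x : ℝ => x * (√(a/π) * exp (-a * x ^ 2))) 0 := by
  refine ⟨?_, int_odd _ (fun x => by simp)⟩
  convert (int_pow a ha 1).const_mul (√(a/π)) using 2
  ring

lemma c3 (a : ℝ) (ha : 0 < a) : HI (fun x : ℝ => x ^ 3 * (√(a/π) * exp (-a * x ^ 2))) 0 := by
  refine ⟨?_, int_odd _ (fun x => by rw [neg_sq]; ring)⟩
  convert (int_pow a ha 3).const_mul (√(a/π)) using 2
  ring

lemma c2 (a : ℝ) (ha : 0 < a) :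
    HI (fun x : ℝ => x ^ 2 * (√(a/π) * exp (-a * x ^ 2))) (1 / (2 * a)) := by
  have hi : Integrable (fun x : ℝ => x ^ 2 * (√(a/π) * exp (-a * x ^ 2))) := by
    convert (int_pow a ha 2).const_mul (√(a/π)) using 2
    ring
  refine ⟨hi, ?_⟩
  have hd : ∀ x : ℝ, HasDerivAt (fun x : ℝ => √(a/π) * exp (-a * x ^ 2))
      (-(2 * a) * (x * (√(a/π) * exp (-a * x ^ 2)))) x := by
    intro x
    have := (((hasDerivAt_pow 2 x).const_mul (-a)).exp).const_mul (√(a/π))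
    refine this.congr_deriv ?_
    norm_num
    ring
  have hp := integral_mul_deriv_eq_deriv_mul_of_integrable (u := fun x : ℝ => x)
    (u' := fun _ => 1) (fun x _ => hasDerivAt_id x) (fun x _ => hd x)
    (by
      convert hi.const_mul (-(2*a)) using 2
      simp only [Pi.mul_apply]; ring)
    (by
      convert (c0 a ha).1 using 2
      simp)
    (by
      exact (c1 a ha).1)
  simp only [one_mul] at hp
  rw [(c0 a ha).2] at hp
  have e : ∀ x : ℝ, x * (-(2 * a) * (x * (√(a/π) * exp (-a * x ^ 2))))
      = -(2*a) * (x ^ 2 * (√(a/π) * exp (-a * x ^ 2))) := fun x => by ring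
  simp only [e, integral_const_mul] at hp
  rw [eq_div_iff (by positivity)]
  linarith

/-- shifted weight -/
noncomputable def W (a U x : ℝ) : ℝ := √(a/π) * exp (-a * (x - U) ^ 2)

lemma HI.shift {f : ℝ → ℝ} {c : ℝ} (h : HI f c) (U : ℝ) : HI (fun x => f (x - U)) c :=
  ⟨h.1.comp_sub_right U, by rw [integral_sub_right_eq_self (fun x => f x) U, h.2]⟩

lemma m0 (a U : ℝ) (ha : 0 < a) : HI (fun x : ℝ => W a U x) 1 := (c0 a ha).shift U

lemma m1 (a U : ℝ) (ha : 0 < a) : HI (fun x : ℝ => x * W a U x) U :=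
  (((c1 a ha).shift U).add ((m0 a U ha).smul U)).congr
    (fun x => by unfold W; ring) (by ring)

lemma m2 (a U : ℝ) (ha : 0 < a) : HI (fun x : ℝ => x ^ 2 * W a U x) (U ^ 2 + 1 / (2 * a)) :=
  ((((c2 a ha).shift U).add ((m1 a U ha).smul (2 * U))).add ((m0 a U ha).smul (-U^2))).congr
    (fun x => by unfold W; ring) (by ring)

lemma m3 (a U : ℝ) (ha : 0 < a) :
    HI (fun x : ℝ => x ^ 3 * W a U x) (U ^ 3 + 3 * U * (1 / (2 * a))) :=
  (((((c3 a ha).shift U).add ((m2 a U ha).smul (3 * U))).add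
    ((m1 a U ha).smul (-3 * U^2))).add ((m0 a U ha).smul (U^3))).congr
    (fun x => by unfold W; ring) (by ring)

/-- multi-dimensional weight -/
noncomputable def G (K : ℕ) (l : ℝ) (ξ : EuclideanSpace ℝ (Fin K)) : ℝ :=
  (l / π) ^ ((K : ℝ) / 2) * exp (- l * ‖ξ‖ ^ 2)

lemma G_eq (K : ℕ) (l : ℝ) (hl : 0 < l) (ξ : EuclideanSpace ℝ (Fin K)) :
    G K l ξ = ∏ i, (√(l/π) * exp (-l * (ξ i) ^ 2)) := by
  have hp : 0 ≤ l / π := by have := Real.pi_pos; positivity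
  rw [Finset.prod_mul_distrib, ← Real.exp_sum, ← Finset.mul_sum, G,
    EuclideanSpace.real_norm_sq_eq]
  congr 1
  rw [Finset.prod_const, Finset.card_univ, Fintype.card_fin, Real.sqrt_eq_rpow,
    ← Real.rpow_natCast, ← Real.rpow_mul hp]
  congr 1
  ring

lemma HI.pi {K : ℕ} {f : Fin K → ℝ → ℝ} {c : Fin K → ℝ} (h : ∀ i, HI (f i) (c i)) :
    HI (fun ξ : EuclideanSpace ℝ (Fin K) => ∏ i, f i (ξ i)) (∏ i, c i) := by
  have h1 : Integrable (fun x : Fin K → ℝ => ∏ i, f i (x i)) :=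
    Integrable.fintype_prod (fun i => (h i).1)
  have h2 : ∫ x : Fin K → ℝ, ∏ i, f i (x i) = ∏ i, c i := by
    rw [integral_fintype_prod_volume_eq_prod]
    exact Finset.prod_congr rfl fun i _ => (h i).2
  have mp := EuclideanSpace.volume_preserving_symm_measurableEquiv_toLp (Fin K)
  have mp' := (MeasurableEquiv.toLp 2 (Fin K → ℝ)).symm.measurableEmbedding
  exact ⟨(mp.integrable_comp_emb mp').2 h1,
    (mp.integral_comp mp' (fun x : Fin K → ℝ => ∏ i, f i (x i))).trans h2⟩

lemma g0 (K : ℕ) (l : ℝ) (hl : 0 < l) : HI (fun ξ => G K l ξ) 1 :=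
  (HI.pi (fun _ : Fin K => c0 l hl)).congr (fun ξ => G_eq K l hl ξ) (by simp)

lemma HI.sum {α ι : Type*} [MeasureSpace α] (s : Finset ι) {f : ι → α → ℝ} {c : ι → ℝ}
    (h : ∀ i, HI (f i) (c i)) : HI (fun x => ∑ i ∈ s, f i x) (∑ i ∈ s, c i) :=
  ⟨integrable_finsetSum _ fun i _ => (h i).1, by
    rw [integral_finsetSum _ fun i _ => (h i).1]
    exact Finset.sum_congr rfl fun i _ => (h i).2⟩

lemma g2 (K : ℕ) (l : ℝ) (hl : 0 < l) : HI (fun ξ => ‖ξ‖ ^ 2 * G K l ξ) (K * (1 / (2 * l))) := by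
  have key : ∀ i : Fin K, HI (fun ξ : EuclideanSpace ℝ (Fin K) => (ξ i) ^ 2 * G K l ξ)
      (1 / (2 * l)) := by
    intro i
    have : ∀ j : Fin K, HI (fun x : ℝ => (if j = i then x ^ 2 else 1) *
        (√(l/π) * exp (-l * x ^ 2))) (if j = i then 1 / (2 * l) else 1) := by
      intro j
      by_cases h : j = i
      · simpa [h] using c2 l hl
      · simpa [h] using c0 l hl
    refine (HI.pi this).congr (fun ξ => ?_) ?_
    · rw [Finset.prod_mul_distrib, ← G_eq K l hl]
      simp
    · simp
  refine (HI.sum Finset.univ key).congr (fun ξ => ?_) ?_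
  · rw [EuclideanSpace.real_norm_sq_eq, Finset.sum_mul]
  · simp

/-- Flux moments (x-direction) of the modified equilibrium distribution. -/
theorem equilibrium_flux_moments
    (K1 K2 : ℕ) (ρ l1 l2 U V : ℝ) (hρ : 0 < ρ) (hl1 : 0 < l1) (hl2 : 0 < l2)
    (g : ℝ → ℝ → EuclideanSpace ℝ (Fin K1) → EuclideanSpace ℝ (Fin K2) → ℝ)
    (hg : ∀ u v ξ1 ξ2, g u v ξ1 ξ2
      = ρ * (l1 * l2 / ((l1 + l2) * π)) * (l1 / π) ^ ((K1 : ℝ) / 2)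
          * (l2 / π) ^ ((K2 : ℝ) / 2)
          * Real.exp (-(l1 * l2 / (l1 + l2)) * ((u - U) ^ 2 + (v - V) ^ 2)
              - l1 * ‖ξ1‖ ^ 2 - l2 * ‖ξ2‖ ^ 2)) :
    (Integrable (fun w : ℝ × ℝ × EuclideanSpace ℝ (Fin K1) × EuclideanSpace ℝ (Fin K2) =>
        w.1 * g w.1 w.2.1 w.2.2.1 w.2.2.2) volume
      ∧ ∫ w : ℝ × ℝ × EuclideanSpace ℝ (Fin K1) × EuclideanSpace ℝ (Fin K2),
          w.1 * g w.1 w.2.1 w.2.2.1 w.2.2.2 = ρ * U)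
    ∧ (Integrable (fun w : ℝ × ℝ × EuclideanSpace ℝ (Fin K1) × EuclideanSpace ℝ (Fin K2) =>
        w.1 ^ 2 * g w.1 w.2.1 w.2.2.1 w.2.2.2) volume
      ∧ ∫ w : ℝ × ℝ × EuclideanSpace ℝ (Fin K1) × EuclideanSpace ℝ (Fin K2),
          w.1 ^ 2 * g w.1 w.2.1 w.2.2.1 w.2.2.2
        = ρ * U ^ 2 + ρ / (2 * l1) + ρ / (2 * l2))
    ∧ (Integrable (fun w : ℝ × ℝ × EuclideanSpace ℝ (Fin K1) × EuclideanSpace ℝ (Fin K2) =>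
        w.1 * w.2.1 * g w.1 w.2.1 w.2.2.1 w.2.2.2) volume
      ∧ ∫ w : ℝ × ℝ × EuclideanSpace ℝ (Fin K1) × EuclideanSpace ℝ (Fin K2),
          w.1 * w.2.1 * g w.1 w.2.1 w.2.2.1 w.2.2.2 = ρ * U * V)
    ∧ (Integrable (fun w : ℝ × ℝ × EuclideanSpace ℝ (Fin K1) × EuclideanSpace ℝ (Fin K2) =>
        w.1 * ((1 / 2) * (w.1 ^ 2 + w.2.1 ^ 2 + ‖w.2.2.1‖ ^ 2 + ‖w.2.2.2‖ ^ 2))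
          * g w.1 w.2.1 w.2.2.1 w.2.2.2) volume
      ∧ ∫ w : ℝ × ℝ × EuclideanSpace ℝ (Fin K1) × EuclideanSpace ℝ (Fin K2),
          w.1 * ((1 / 2) * (w.1 ^ 2 + w.2.1 ^ 2 + ‖w.2.2.1‖ ^ 2 + ‖w.2.2.2‖ ^ 2))
            * g w.1 w.2.1 w.2.2.1 w.2.2.2
        = (1 / 2) * ρ * U * (U ^ 2 + V ^ 2 + ((K1 : ℝ) + 4) / (2 * l1)
            + ((K2 : ℝ) + 4) / (2 * l2))) := by
  have hs : 0 < l1 + l2 := by positivity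
  have hpi := Real.pi_pos
  obtain ⟨a, ha⟩ : ∃ a, a = l1 * l2 / (l1 + l2) := ⟨_, rfl⟩
  have ha0 : 0 < a := by rw [ha]; positivity
  have hai : 1 / (2 * a) = 1 / (2 * l1) + 1 / (2 * l2) := by
    rw [ha]; field_simp; ring
  have hG : ∀ u v ξ1 ξ2, g u v ξ1 ξ2 =
      ρ * (W a U u * (W a V v * (G K1 l1 ξ1 * G K2 l2 ξ2))) := by
    intro u v ξ1 ξ2
    have e1 : l1 * l2 / ((l1 + l2) * π) = √(a/π) * √(a/π) := by
      rw [Real.mul_self_sqrt (by positivity), ha]; field_simp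
    have e2 : -(l1 * l2 / (l1 + l2)) * ((u - U) ^ 2 + (v - V) ^ 2)
              - l1 * ‖ξ1‖ ^ 2 - l2 * ‖ξ2‖ ^ 2 = -a * (u - U) ^ 2 + (-a * (v - V) ^ 2
              + (-l1 * ‖ξ1‖ ^ 2 + -l2 * ‖ξ2‖ ^ 2)) := by rw [ha]; ring
    rw [hg, e1, e2, Real.exp_add, Real.exp_add, Real.exp_add]
    unfold W G
    ring
  clear hg
  have z1 := g0 K1 l1 hl1
  have z2 := g0 K2 l2 hl2
  have y1 := g2 K1 l1 hl1
  have y2 := g2 K2 l2 hl2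
  have v0 := m0 a V ha0
  have v1 := m1 a V ha0
  have v2 := m2 a V ha0
  have u1 := m1 a U ha0
  have u2 := m2 a U ha0
  have u3 := m3 a U ha0
  rw [hai] at v2 u2 u3
  refine ⟨?_, ?_, ?_, ?_⟩
  · exact ((u1.prod (v0.prod (z1.prod z2))).smul ρ).congr
      (fun w => by rw [hG]; ring) (by ring)
  · exact ((u2.prod (v0.prod (z1.prod z2))).smul ρ).congr
      (fun w => by rw [hG]; ring) (by ring)
  · exact ((u1.prod (v1.prod (z1.prod z2))).smul ρ).congr
      (fun w => by rw [hG]; ring) (by ring)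
  · exact (((((u3.prod (v0.prod (z1.prod z2))).add (u1.prod (v2.prod (z1.prod z2)))).add
      (u1.prod (v0.prod (y1.prod z2)))).add (u1.prod (v0.prod (z1.prod y2)))).smul
      (1 / 2 * ρ)).congr
      (fun w => by rw [hG]; ring) (by field_simp; ring)
end

section
/- Let ρ, λ1, λ2 > 0, U, V ∈ ℝ and K1, K2 ≥ 0 be real numbers, and let M be the 4×6 real matrix equal to ρ times the matrix with rows: row 1 = (1, U, V, B1', K1/(4λ1), K2/(4λ2)); row 2 = (U, U² + 1/(2λ1) + 1/(2λ2), UV, B2', K1 U/(4λ1), K2 U/(4λ2)); row 3 = (V, UV, V² + 1/(2λ1) + 1/(2λ2), B3', K1 V/(4λ1), K2 V/(4λ2)); row 4 = (B1, B2, B3, B4, B5, B6), with B1' = (1/2)(U²+V²+1/λ1+1/λ2), B2' = (1/2)U(U²+V²+2/λ1+2/λ2), B3' = (1/2)V(U²+V²+2/λ1+2/λ2), B1 = (1/2)(U²+V²+(K1+2)/(2λ1)+(K2+2)/(2λ2)), B2 = (1/2)U(U²+V²+(K1+4)/(2λ1)+(K2+4)/(2λ2)), B3 = (1/2)V(U²+V²+(K1+4)/(2λ1)+(K2+4)/(2λ2)),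 B4 = (1/4)[ (U²+V²+1/λ1+1/λ2)(U²+V²+(K1+2)/(2λ1)+(K2+2)/(2λ2)) + (2/λ1+2/λ2)(U²+V²+1/(2λ1)+1/(2λ2)) ], B5 = (1/4)[ (K1/(2λ1))(U²+V²) + (K1²+4K1)/(4λ1²) + K1(K2+2)/(4λ1λ2) ], B6 = (1/4)[ (K2/(2λ2))(U²+V²) + (K2²+4K2)/(4λ2²) + K2(K1+2)/(4λ1λ2) ]. Given any d = (d1, d2, d3, d4) ∈ ℝ⁴ and any a5, a6 ∈ ℝ, set L := 1/(2λ1) + 1/(2λ2), A := d4 − (1/2)(U²+V²+(K1+2)/(2λ1)+(K2+2)/(2λ2)) d1, B := d2 − U d1, C := d3 − V d1, and define a4 := ( (A − U B − V C)/ρ − (K1/(8λ1²)) a5 − (K2/(8λ2²)) a6 ) / L², a3 := C/(ρ L) − V a4, a2 := B/(ρ L) − U a4, a1 := d1/ρ − U a2 − V a3 − B1' a4 − (K1/(4λ1)) a5 − (K2/(4λ2)) a6. Then the vector a = (a1, a2, a3, a4, a5, a6) ∈ ℝ⁶ satisfies M a = d. -/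
/-- The explicit formulas for `a1, a2, a3, a4` solve the underdetermined
4×6 linear system `M a = d` for any choice of `a5, a6`. -/
theorem moment_matrix_system_solution
    (ρ l1 l2 U V K1 K2 : ℝ)
    (hρ : 0 < ρ) (hl1 : 0 < l1) (hl2 : 0 < l2) (hK1 : 0 ≤ K1) (hK2 : 0 ≤ K2)
    (B1' B2' B3' B1 B2 B3 B4 B5 B6 : ℝ)
    (hB1' : B1' = (1 / 2) * (U ^ 2 + V ^ 2 + 1 / l1 + 1 / l2))
    (hB2' : B2' = (1 / 2) * U * (U ^ 2 + V ^ 2 + 2 / l1 + 2 / l2))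
    (hB3' : B3' = (1 / 2) * V * (U ^ 2 + V ^ 2 + 2 / l1 + 2 / l2))
    (hB1 : B1 = (1 / 2) * (U ^ 2 + V ^ 2 + (K1 + 2) / (2 * l1) + (K2 + 2) / (2 * l2)))
    (hB2 : B2 = (1 / 2) * U * (U ^ 2 + V ^ 2 + (K1 + 4) / (2 * l1) + (K2 + 4) / (2 * l2)))
    (hB3 : B3 = (1 / 2) * V * (U ^ 2 + V ^ 2 + (K1 + 4) / (2 * l1) + (K2 + 4) / (2 * l2)))
    (hB4 : B4 = (1 / 4) * ((U ^ 2 + V ^ 2 + 1 / l1 + 1 / l2)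
          * (U ^ 2 + V ^ 2 + (K1 + 2) / (2 * l1) + (K2 + 2) / (2 * l2))
        + (2 / l1 + 2 / l2) * (U ^ 2 + V ^ 2 + 1 / (2 * l1) + 1 / (2 * l2))))
    (hB5 : B5 = (1 / 4) * ((K1 / (2 * l1)) * (U ^ 2 + V ^ 2)
        + (K1 ^ 2 + 4 * K1) / (4 * l1 ^ 2) + K1 * (K2 + 2) / (4 * l1 * l2)))
    (hB6 : B6 = (1 / 4) * ((K2 / (2 * l2)) * (U ^ 2 + V ^ 2)
        + (K2 ^ 2 + 4 * K2) / (4 * l2 ^ 2) + K2 * (K1 + 2) / (4 * l1 * l2)))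
    (M : Matrix (Fin 4) (Fin 6) ℝ)
    (hM : M = ρ • Matrix.of
      ![![1, U, V, B1', K1 / (4 * l1), K2 / (4 * l2)],
        ![U, U ^ 2 + 1 / (2 * l1) + 1 / (2 * l2), U * V, B2',
          K1 * U / (4 * l1), K2 * U / (4 * l2)],
        ![V, U * V, V ^ 2 + 1 / (2 * l1) + 1 / (2 * l2), B3',
          K1 * V / (4 * l1), K2 * V / (4 * l2)],
        ![B1, B2, B3, B4, B5, B6]])
    (d1 d2 d3 d4 a5 a6 : ℝ)
    (L A B C a4 a3 a2 a1 : ℝ)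
    (hL : L = 1 / (2 * l1) + 1 / (2 * l2))
    (hA : A = d4 - (1 / 2) * (U ^ 2 + V ^ 2 + (K1 + 2) / (2 * l1)
        + (K2 + 2) / (2 * l2)) * d1)
    (hB : B = d2 - U * d1)
    (hC : C = d3 - V * d1)
    (ha4 : a4 = ((A - U * B - V * C) / ρ - (K1 / (8 * l1 ^ 2)) * a5
        - (K2 / (8 * l2 ^ 2)) * a6) / L ^ 2)
    (ha3 : a3 = C / (ρ * L) - V * a4)
    (ha2 : a2 = B / (ρ * L) - U * a4)
    (ha1 : a1 = d1 / ρ - U * a2 - V * a3 - B1' * a4 - (K1 / (4 * l1)) * a5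
        - (K2 / (4 * l2)) * a6) :
    M.mulVec ![a1, a2, a3, a4, a5, a6] = ![d1, d2, d3, d4] := by
  have hLpos : 0 < L := by rw [hL]; positivity
  have hρ0 := hρ.ne'
  have hL0 := hLpos.ne'
  have e4 : ρ * L ^ 2 * a4 = (A - U * B - V * C) - ρ * (K1 / (8 * l1 ^ 2)) * a5
        - ρ * (K2 / (8 * l2 ^ 2)) * a6 := by
    have h : L ^ 2 * a4 = (A - U * B - V * C) / ρ - (K1 / (8 * l1 ^ 2)) * a5
        - (K2 / (8 * l2 ^ 2)) * a6 := by
      rw [ha4]; exact mul_div_cancel₀ _ (pow_ne_zero 2 hL0)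
    have h' : ρ * ((A - U * B - V * C) / ρ) = A - U * B - V * C := mul_div_cancel₀ _ hρ0
    linear_combination ρ * h + h'
  have e3 : ρ * L * (a3 + V * a4) = C := by
    rw [ha3, sub_add_cancel]; exact mul_div_cancel₀ _ (mul_ne_zero hρ0 hL0)
  have e2 : ρ * L * (a2 + U * a4) = B := by
    rw [ha2, sub_add_cancel]; exact mul_div_cancel₀ _ (mul_ne_zero hρ0 hL0)
  have e1 : ρ * (a1 + U * a2 + V * a3 + B1' * a4 + (K1 / (4 * l1)) * a5
        + (K2 / (4 * l2)) * a6) = d1 := by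
    have h' : ρ * (d1 / ρ) = d1 := mul_div_cancel₀ _ hρ0
    linear_combination ρ * ha1 + h'
  clear ha1 ha2 ha3 ha4
  subst hB1' hB2' hB3' hB1 hB2 hB3 hB4 hB5 hB6 hA hB hC hM
  subst hL
  ext i
  fin_cases i <;>
    simp [Matrix.mulVec, dotProduct, Fin.sum_univ_succ, -one_div]
  · linear_combination e1
  · linear_combination U * e1 + e2
  · linear_combination V * e1 + e3
  · linear_combination (1 / 2) * (U ^ 2 + V ^ 2 + (K1 + 2) / (2 * l1)
        + (K2 + 2) / (2 * l2)) * e1 + U * e2 + V * e3 + e4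
end

section
/- Let ρ, λ1, λ2 > 0, U, V ∈ ℝ and K1, K2 ≥ 0 be real numbers. Let M₄ be the 4×4 real matrix formed by the first four columns of the matrix M from the appendix, i.e. M₄ equals ρ times the matrix with rows (1, U, V, B1'), (U, U² + 1/(2λ1) + 1/(2λ2), UV, B2'), (V, UV, V² + 1/(2λ1) + 1/(2λ2), B3'), (B1, B2, B3, B4), where B1' = (1/2)(U²+V²+1/λ1+1/λ2), B2' = (1/2)U(U²+V²+2/λ1+2/λ2), B3' = (1/2)V(U²+V²+2/λ1+2/λ2), B1 = (1/2)(U²+V²+(K1+2)/(2λ1)+(K2+2)/(2λ2)), B2 = (1/2)U(U²+V²+(K1+4)/(2λ1)+(K2+4)/(2λ2)), B3 = (1/2)V(U²+V²+(K1+4)/(2λ1)+(K2+4)/(2λ2)), B4 = (1/4)[ (U²+V²+1/λ1+1/λ2)(U²+V²+(K1+2)/(2λ1)+(K2+2)/(2λ2)) + (2/λ1+2/λ2)(U²+V²+1/(2λ1)+1/(2λ2)) ]. Then M₄ is invertible; consequently, for every d ∈ ℝ⁴ and every fixed pair (a5, a6) ∈ ℝ², the 4×6 system M a = d has a unique solution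 (a1, a2, a3, a4) once the last two components are fixed to (a5, a6). -/
/-- The leading 4×4 block of the moment matrix is invertible; consequently
the 4×6 system `M a = d` has a unique solution once `a5, a6` are fixed. -/
theorem moment_matrix_block_invertible
    (ρ l1 l2 U V K1 K2 : ℝ)
    (hρ : 0 < ρ) (hl1 : 0 < l1) (hl2 : 0 < l2) (hK1 : 0 ≤ K1) (hK2 : 0 ≤ K2)
    (B1' B2' B3' B1 B2 B3 B4 B5 B6 : ℝ)
    (hB1' : B1' = (1 / 2) * (U ^ 2 + V ^ 2 + 1 / l1 + 1 / l2))
    (hB2' : B2' = (1 / 2) * U * (U ^ 2 + V ^ 2 + 2 / l1 + 2 / l2))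
    (hB3' : B3' = (1 / 2) * V * (U ^ 2 + V ^ 2 + 2 / l1 + 2 / l2))
    (hB1 : B1 = (1 / 2) * (U ^ 2 + V ^ 2 + (K1 + 2) / (2 * l1) + (K2 + 2) / (2 * l2)))
    (hB2 : B2 = (1 / 2) * U * (U ^ 2 + V ^ 2 + (K1 + 4) / (2 * l1) + (K2 + 4) / (2 * l2)))
    (hB3 : B3 = (1 / 2) * V * (U ^ 2 + V ^ 2 + (K1 + 4) / (2 * l1) + (K2 + 4) / (2 * l2)))
    (hB4 : B4 = (1 / 4) * ((U ^ 2 + V ^ 2 + 1 / l1 + 1 / l2)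
          * (U ^ 2 + V ^ 2 + (K1 + 2) / (2 * l1) + (K2 + 2) / (2 * l2))
        + (2 / l1 + 2 / l2) * (U ^ 2 + V ^ 2 + 1 / (2 * l1) + 1 / (2 * l2))))
    (hB5 : B5 = (1 / 4) * ((K1 / (2 * l1)) * (U ^ 2 + V ^ 2)
        + (K1 ^ 2 + 4 * K1) / (4 * l1 ^ 2) + K1 * (K2 + 2) / (4 * l1 * l2)))
    (hB6 : B6 = (1 / 4) * ((K2 / (2 * l2)) * (U ^ 2 + V ^ 2)
        + (K2 ^ 2 + 4 * K2) / (4 * l2 ^ 2) + K2 * (K1 + 2) / (4 * l1 * l2)))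
    (M : Matrix (Fin 4) (Fin 6) ℝ)
    (hM : M = ρ • Matrix.of
      ![![1, U, V, B1', K1 / (4 * l1), K2 / (4 * l2)],
        ![U, U ^ 2 + 1 / (2 * l1) + 1 / (2 * l2), U * V, B2',
          K1 * U / (4 * l1), K2 * U / (4 * l2)],
        ![V, U * V, V ^ 2 + 1 / (2 * l1) + 1 / (2 * l2), B3',
          K1 * V / (4 * l1), K2 * V / (4 * l2)],
        ![B1, B2, B3, B4, B5, B6]])
    (M4 : Matrix (Fin 4) (Fin 4) ℝ)
    (hM4 : M4 = ρ • Matrix.of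
      ![![1, U, V, B1'],
        ![U, U ^ 2 + 1 / (2 * l1) + 1 / (2 * l2), U * V, B2'],
        ![V, U * V, V ^ 2 + 1 / (2 * l1) + 1 / (2 * l2), B3'],
        ![B1, B2, B3, B4]]) :
    IsUnit M4
    ∧ ∀ (d : Fin 4 → ℝ) (a5 a6 : ℝ),
        ∃! a : Fin 6 → ℝ, M.mulVec a = d ∧ a 4 = a5 ∧ a 5 = a6 := by
  have hdet : M4.det = ρ ^ 4 * (1 / (2 * l1) + 1 / (2 * l2)) ^ 4 := by
    have e1 : 1 / l1 = 2 * (1 / (2 * l1)) := by field_simp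
    have e2 : 1 / l2 = 2 * (1 / (2 * l2)) := by field_simp
    have e3 : ∀ c x : ℝ, c / x = c * (1 / x) := fun c x => by ring
    rw [hM4, Matrix.det_smul, Fintype.card_fin]
    congr 1
    rw [hB1', hB2', hB3', hB1, hB2, hB3, hB4, e3 2 l1, e3 2 l2, e3 (K1 + 2), e3 (K2 + 2),
      e3 (K1 + 4), e3 (K2 + 4), e1, e2]
    generalize 1 / (2 * l1) = x
    generalize 1 / (2 * l2) = y
    simp [Matrix.det_succ_row_zero, Fin.sum_univ_succ, Fin.succAbove]
    ring
  have hu : IsUnit M4.det := by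
    rw [hdet]
    exact (by positivity : ρ ^ 4 * (1 / (2 * l1) + 1 / (2 * l2)) ^ 4 ≠ 0).isUnit
  refine ⟨(Matrix.isUnit_iff_isUnit_det M4).2 hu, ?_⟩
  intro d a5 a6
  have key : ∀ a : Fin 6 → ℝ, M.mulVec a = M4.mulVec ![a 0, a 1, a 2, a 3]
      + (fun i => M i 4 * a 4 + M i 5 * a 5) := by
    intro a
    rw [hM, hM4]
    clear * -
    ext i
    fin_cases i <;> simp [Matrix.mulVec, dotProduct, Fin.sum_univ_succ] <;> ring_nf <;> rfl
  set c : Fin 4 → ℝ := fun i => M i 4 * a5 + M i 5 * a6 with hc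
  set b := M4⁻¹.mulVec (d - c) with hb
  refine ⟨![b 0, b 1, b 2, b 3, a5, a6], ⟨?_, rfl, rfl⟩, ?_⟩
  · rw [key]
    have h1 : M4.mulVec b = d - c := by
      rw [hb, Matrix.mulVec_mulVec, Matrix.mul_nonsing_inv _ hu, Matrix.one_mulVec]
    have h2 : ![b 0, b 1, b 2, b 3] = b := by
      ext i; fin_cases i <;> rfl
    change M4.mulVec ![b 0, b 1, b 2, b 3] + c = d
    rw [h2, h1]; simp
  · rintro a ⟨h, h4, h5⟩
    rw [key, h4, h5] at h
    have h1 : ![a 0, a 1, a 2, a 3] = b := by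
      rw [hb, ← h, hc, add_sub_cancel_right, Matrix.mulVec_mulVec, Matrix.nonsing_inv_mul _ hu,
        Matrix.one_mulVec]
    rw [← h1]
    ext i
    fin_cases i
    · rfl
    · rfl
    · rfl
    · rfl
    · exact h4
    · exact h5
end
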